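/- arXiv:1804.06075 — 3 statements merged into one kernel-verified Lean document; each statement's English description precedes it below -/
import Mathlib

section
/- Fourth-order 2-point function of the 2D noncommutative 3-colour model: let G₀(x,y) := 1/(1+x+y) and G₂(x,y) := 2(log(1+x) − log(1+y))/((1+x+y)²(x−y)) for x ≠ y, extended continuously by G₂(x,x) := 2/((1+2x)²(1+x)). Then for all real p₁, p₂ > 0 with p₁ ≠ p₂, lim_{Λ→∞} (1/((1+p₁+p₂)(p₁−p₂))) · { 3 [ G₀(p₁,p₂) ∫₀^Λ (G₂(q,p₂) − G₂(p₁,q)) dq + G₂(p₁,p₂) ∫₀^Λ (G₀(q,p₂) − G₀(p₁,q)) dq ] − ∫₀^Λ (G₂(p₁,q) − G₂(p₁,p₂))/(q−p₂) dq + ∫₀^Λ (G₂(p₂,q) − G₂(p₁,p₂))/(q−p₁) dq } = (2/((1+p₁+p₂)²(p₁−p₂))) · [ 3(log(1+p₁) − log(1+p₂))²/((1+p₁+p₂)(p₁−p₂)) + 2log(1+p₁)/(p₁(1+2p₁)(1+p₁)) − 2log(1+p₂)/(p₂(1+2p₂)(1+p₂)) − (1+2p₂)(π²/6 − 2Li₂(−p₁)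 − log²(1+p₁))/((1+2p₁)²(1+p₁+p₂)) + (1+2p₁)(π²/6 − 2Li₂(−p₂) − log²(1+p₂))/((1+2p₂)²(1+p₁+p₂)) ], the removable singularities of the integrands at q = p₂ (third integral) and q = p₁ (fourth integral) being filled in by continuity. -/
open MeasureTheory Real Filter

/-- The real dilogarithm, `Li₂(x) = −∫₀ˣ log(1−u)/u du`. -/
noncomputable def Li2 (x : ℝ) : ℝ := -∫ u in (0:ℝ)..x, Real.log (1 - u) / u

/-- Zeroth-order 2-point function `G₀(x,y) = 1/(1+x+y)`. -/
noncomputable def G0 (x y : ℝ) : ℝ := 1 / (1 + x + y)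

/-- Second-order 2-point function `G₂(x,y) = 2(log(1+x) − log(1+y))/((1+x+y)²(x−y))`
for `x ≠ y`, extended continuously by `G₂(x,x) = 2/((1+2x)²(1+x))`. -/
noncomputable def G2 (x y : ℝ) : ℝ :=
  if x = y then 2 / ((1 + 2 * x) ^ 2 * (1 + x))
  else 2 * (Real.log (1 + x) - Real.log (1 + y)) / ((1 + x + y) ^ 2 * (x - y))

/-- auxiliary kernel `-log(1-x)/x` with its continuous extension at `0`. -/
noncomputable def gker (x : ℝ) : ℝ := dslope (fun u : ℝ => -Real.log (1 - u)) 0 x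

lemma gker_ne {x : ℝ} (hx : x ≠ 0) : gker x = -Real.log (1 - x) / x := by
  unfold gker
  rw [dslope_of_ne _ hx, slope_def_field]
  simp

lemma hasDerivAt_nlog {x : ℝ} (hx : x < 1) :
    HasDerivAt (fun u : ℝ => -Real.log (1 - u)) (1 / (1 - x)) x := by
  have h : HasDerivAt (fun u : ℝ => 1 - u) (-1) x := by
    simpa using (hasDerivAt_id x).const_sub 1
  have h2 := (h.log (by linarith)).neg
  convert! h2 using 1
  ring

lemma gker_zero : gker 0 = 1 := by
  unfold gker
  rw [dslope_same, (hasDerivAt_nlog (by norm_num)).deriv]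
  norm_num

lemma continuousOn_gker : ContinuousOn gker (Set.Iio 1) := by
  unfold gker
  refine (continuousOn_dslope (Iio_mem_nhds (by norm_num))).2 ⟨?_, ?_⟩
  · intro x hx
    exact (hasDerivAt_nlog hx).continuousAt.continuousWithinAt
  · exact (hasDerivAt_nlog (by norm_num)).differentiableAt

lemma ae_ne (c : ℝ) : ∀ᵐ u : ℝ ∂volume, u ≠ c := by
  simp [ae_iff]

lemma Li2_eq (x : ℝ) : Li2 x = ∫ u in (0:ℝ)..x, gker u := by
  unfold Li2
  rw [← intervalIntegral.integral_neg]
  apply intervalIntegral.integral_congr_ae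
  filter_upwards [ae_ne 0] with u hu _
  rw [gker_ne hu]
  ring

lemma hasDerivAt_Li2 {x : ℝ} (hx : x < 1) : HasDerivAt Li2 (gker x) x := by
  have h : Li2 = fun x => ∫ u in (0:ℝ)..x, gker u := funext Li2_eq
  rw [h]
  have hsub : Set.uIcc 0 x ⊆ Set.Iio 1 := by
    intro y hy
    rw [Set.mem_uIcc] at hy
    rcases hy with hy | hy
    · exact lt_of_le_of_lt hy.2 hx
    · exact lt_of_le_of_lt hy.2 (by norm_num)
  refine intervalIntegral.integral_hasDerivAt_right
    (continuousOn_gker.mono hsub).intervalIntegrable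
    (continuousOn_gker.stronglyMeasurableAtFilter isOpen_Iio x hx)
    (continuousOn_gker.continuousAt (Iio_mem_nhds hx))

lemma Li2_comp {f : ℝ → ℝ} {f' x : ℝ} (hf : HasDerivAt f f' x) (h : f x < 1) :
    HasDerivAt (fun y => Li2 (f y)) (gker (f x) * f') x :=
  HasDerivAt.comp (h₂ := Li2) x (hasDerivAt_Li2 h) hf

lemma Li2_zero : Li2 0 = 0 := by simp [Li2]

lemma sum_alt : HasSum (fun n : ℕ => (-1 : ℝ) ^ (n + 1) / ((n : ℝ) + 1) ^ 2) (-(π ^ 2 / 12)) := by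
  have h := hasSum_one_div_nat_pow_mul_cos (k := 1) one_ne_zero (x := 1 / 2)
    (by constructor <;> norm_num)
  rw [← hasSum_nat_add_iff' 1] at h
  convert! h using 1
  · funext n
    have : 2 * π * ((n + 1 : ℕ) : ℝ) * (1 / 2) = ((n + 1 : ℕ) : ℝ) * π := by ring
    rw [this, Real.cos_nat_mul_pi]
    push_cast
    ring
  · have hB : (Polynomial.map (algebraMap ℚ ℝ) (Polynomial.bernoulli (2 * 1))).eval (1 / 2)
        = -(1 / 12) := by
      simp [Polynomial.bernoulli, Finset.sum_range_succ, Polynomial.eval_add]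
      norm_num [Nat.choose, bernoulli, bernoulli'_two]
    rw [hB]
    norm_num [Nat.factorial]
    ring

lemma Li2_neg_one : Li2 (-1) = -(π ^ 2 / 12) := by
  have h1 : Li2 (-1) = ∫ t in (0:ℝ)..1, -gker (-t) := by
    rw [Li2_eq, intervalIntegral.integral_neg, intervalIntegral.integral_comp_neg,
      intervalIntegral.integral_symm]
    simp
  have key := hasSum_integral_of_summable_integral_norm
    (μ := volume.restrict (Set.Ioc (0:ℝ) 1))
    (F := fun (n : ℕ) (t : ℝ) => (-1 : ℝ) ^ (n + 1) / ((n : ℝ) + 1) * t ^ n) ?_ ?_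
  · have e1 : ∀ n : ℕ, (∫ t in Set.Ioc (0:ℝ) 1, (-1 : ℝ) ^ (n + 1) / ((n : ℝ) + 1) * t ^ n)
        = (-1 : ℝ) ^ (n + 1) / ((n : ℝ) + 1) ^ 2 := by
      intro n
      rw [← intervalIntegral.integral_of_le zero_le_one, intervalIntegral.integral_const_mul,
        integral_pow]
      field_simp
      simp
    simp only [e1] at key
    rw [h1, intervalIntegral.integral_of_le zero_le_one, ← key.unique sum_alt]
    have h1' : ∀ᵐ u : ℝ ∂(volume.restrict (Set.Ioc (0:ℝ) 1)), u ≠ 1 :=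
      ae_restrict_of_ae (ae_ne 1)
    apply integral_congr_ae
    filter_upwards [h1', ae_restrict_mem measurableSet_Ioc] with t ht1 ht
    have hlt : t < 1 := lt_of_le_of_ne ht.2 ht1
    have ht0 : t ≠ 0 := ht.1.ne'
    have hs := hasSum_pow_div_log_of_abs_lt_one (x := -t)
      (by rw [abs_neg, abs_of_pos ht.1]; exact hlt)
    rw [gker_ne (neg_ne_zero.2 ht0)]
    have hs2 := hs.mul_right (1 / t)
    rw [show -(-Real.log (1 - -t) / -t) = -Real.log (1 - -t) * (1 / t) by field_simp]
    rw [← hs2.tsum_eq]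
    congr 1
    funext n
    rw [neg_pow]
    field_simp
    ring
  · intro n
    have : Continuous (fun t : ℝ => (-1 : ℝ) ^ (n + 1) / ((n : ℝ) + 1) * t ^ n) := by fun_prop
    exact (this.intervalIntegrable 0 1).1
  · have e2 : ∀ n : ℕ, (∫ t in Set.Ioc (0:ℝ) 1, ‖(-1 : ℝ) ^ (n + 1) / ((n : ℝ) + 1) * t ^ n‖)
        = ‖(-1 : ℝ) ^ (n + 1) / ((n : ℝ) + 1) ^ 2‖ := by
      intro n
      have : ∀ t ∈ Set.Ioc (0:ℝ) 1, ‖(-1 : ℝ) ^ (n + 1) / ((n : ℝ) + 1) * t ^ n‖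
          = 1 / ((n : ℝ) + 1) * t ^ n := by
        intro t ht
        have h0 : (0:ℝ) < (n : ℝ) + 1 := by positivity
        rw [norm_mul, norm_div, norm_pow, norm_neg, norm_one, one_pow, Real.norm_of_nonneg h0.le,
          Real.norm_of_nonneg (pow_nonneg ht.1.le n)]
      rw [setIntegral_congr_fun measurableSet_Ioc this,
        ← intervalIntegral.integral_of_le zero_le_one, intervalIntegral.integral_const_mul,
        integral_pow]
      have h0 : (0:ℝ) < (n : ℝ) + 1 := by positivity
      rw [norm_div, norm_pow, norm_neg, norm_one, one_pow, norm_pow, Real.norm_of_nonneg h0.le]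
      field_simp
      simp
    simp only [e2]
    exact sum_alt.summable.norm

/-- constancy principle -/
lemma const_on {s : Set ℝ} (hs : IsOpen s) (hc : IsPreconnected s) {f : ℝ → ℝ}
    (hf : ∀ x ∈ s, HasDerivAt f 0 x) {x y : ℝ} (hx : x ∈ s) (hy : y ∈ s) : f x = f y := by
  obtain ⟨a, ha⟩ := hs.exists_is_const_of_deriv_eq_zero hc
    (fun z hz => (hf z hz).differentiableAt.differentiableWithinAt)
    (fun z hz => (hf z hz).deriv)
  rw [ha x hx, ha y hy]

lemma Li2_inv {x : ℝ} (hx : 0 < x) :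
    Li2 (-x) + Li2 (-x⁻¹) + Real.log x ^ 2 / 2 = -(π ^ 2 / 6) := by
  have h := const_on (s := Set.Ioi 0) isOpen_Ioi isPreconnected_Ioi
    (f := fun x => Li2 (-x) + Li2 (-x⁻¹) + Real.log x ^ 2 / 2) ?_ hx (y := 1) (by simp)
  · beta_reduce at h
    rw [h, inv_one, Li2_neg_one]
    simp
    ring
  · intro y hy
    have hy : 0 < y := hy
    have hi : 0 < y⁻¹ := inv_pos.2 hy
    have a1 : HasDerivAt (fun x => Li2 (-x)) (gker (-y) * (-1)) y :=
      Li2_comp (hasDerivAt_neg y) (by linarith)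
    have a2 : HasDerivAt (fun x => Li2 (-x⁻¹)) (gker (-y⁻¹) * (-(-(y ^ 2)⁻¹))) y :=
      Li2_comp (f := fun x => -x⁻¹) (hasDerivAt_inv hy.ne').neg (by linarith)
    have a3 := ((Real.hasDerivAt_log hy.ne').pow 2).div_const 2
    convert! (a1.add a2).add a3 using 1
    rw [gker_ne (by linarith), gker_ne (by linarith)]
    have : Real.log (1 - -y⁻¹) = Real.log (1 - -y) - Real.log y := by
      rw [← Real.log_div (by linarith) hy.ne']
      congr 1
      field_simp
      ring
    rw [this]
    field_simp
    ring

lemma Li2_landen {a : ℝ} (ha : 0 < a) :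
    Li2 (a / (1 + a)) = -Li2 (-a) - Real.log (1 + a) ^ 2 / 2 := by
  have h := const_on (s := Set.Ioi (-1)) isOpen_Ioi isPreconnected_Ioi
    (f := fun x => Li2 (x / (1 + x)) + Li2 (-x) + Real.log (1 + x) ^ 2 / 2) ?_
    (x := a) (y := 0) (by simp; linarith) (by simp)
  · beta_reduce at h
    simp [Li2_zero] at h
    linarith
  · intro y hy
    have hy : 0 < 1 + y := by have : -1 < y := hy; linarith
    have hl : HasDerivAt (fun x : ℝ => 1 + x) 1 y := by
      simpa using (hasDerivAt_id y).const_add 1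
    have hq : HasDerivAt (fun x : ℝ => x / (1 + x)) (1 / (1 + y) ^ 2) y := by
      convert! (hasDerivAt_id y).div hl hy.ne' using 1
      simp
    have a1 : HasDerivAt (fun x => Li2 (-x)) (gker (-y) * (-1)) y :=
      Li2_comp (hasDerivAt_neg y) (by linarith)
    have a2 : HasDerivAt (fun x => Li2 (x / (1 + x))) (gker (y / (1 + y)) * (1 / (1 + y) ^ 2)) y :=
      Li2_comp hq (by rw [div_lt_one hy]; linarith)
    have a3 := ((hl.log hy.ne').pow 2).div_const 2
    convert! (a2.add a1).add a3 using 1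
    by_cases h0 : y = 0
    · subst h0
      simp [gker_zero]
    · rw [gker_ne (neg_ne_zero.2 h0), gker_ne (div_ne_zero h0 hy.ne')]
      have : Real.log (1 - y / (1 + y)) = - Real.log (1 + y) := by
        rw [← Real.log_inv]
        congr 1
        field_simp
        ring
      rw [this, sub_neg_eq_add]
      field_simp
      ring

/-- divided difference of `log (1 + ·)` -/
noncomputable def Dd (a q : ℝ) : ℝ := dslope (fun u : ℝ => Real.log (1 + u)) a q

lemma hasDerivAt_log1 {x : ℝ} (hx : 0 < 1 + x) :
    HasDerivAt (fun u : ℝ => Real.log (1 + u)) (1 / (1 + x)) x := by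
  have hl : HasDerivAt (fun x : ℝ => 1 + x) 1 x := by
    simpa using (hasDerivAt_id x).const_add 1
  exact hl.log hx.ne'

lemma Dd_ne {a q : ℝ} (h : q ≠ a) :
    Dd a q = (Real.log (1 + q) - Real.log (1 + a)) / (q - a) := by
  unfold Dd
  rw [dslope_of_ne _ h, slope_def_field]

lemma Dd_same {a : ℝ} (ha : 0 < a) : Dd a a = 1 / (1 + a) := by
  unfold Dd
  rw [dslope_same, (hasDerivAt_log1 (by linarith)).deriv]

lemma Dd_mul (a q : ℝ) : Dd a q * (q - a) = Real.log (1 + q) - Real.log (1 + a) := by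
  by_cases h : q = a
  · subst h; simp
  · rw [Dd_ne h, div_mul_cancel₀ _ (sub_ne_zero.2 h)]

lemma continuousOn_Dd {a : ℝ} (ha : 0 < a) : ContinuousOn (Dd a) (Set.Ioi (-1)) := by
  unfold Dd
  refine (continuousOn_dslope (Ioi_mem_nhds (by linarith))).2 ⟨?_, ?_⟩
  · intro x hx
    have : -1 < x := hx
    exact (hasDerivAt_log1 (by linarith)).continuousAt.continuousWithinAt
  · exact (hasDerivAt_log1 (by linarith)).differentiableAt

lemma hasDerivAt_DdInt {a q : ℝ} (ha : 0 < a) (hq : 0 < 1 + q) :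
    HasDerivAt (fun q => -Li2 ((a - q) / (1 + a))) (Dd a q) q := by
  have ha1 : 0 < 1 + a := by linarith
  have h1 : HasDerivAt (fun q => (a - q) / (1 + a)) (-1 / (1 + a)) q := by
    simpa using ((hasDerivAt_id q).const_sub a).div_const (1 + a)
  have h2 := (Li2_comp h1 (by rw [div_lt_one ha1]; linarith)).neg
  convert! h2 using 1
  by_cases h : q = a
  · subst h
    rw [Dd_same ha, sub_self, zero_div, gker_zero]
    ring
  · have h' : a - q ≠ 0 := sub_ne_zero.2 (Ne.symm h)
    have h'' : q - a ≠ 0 := sub_ne_zero.2 h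
    rw [Dd_ne h, gker_ne (div_ne_zero h' ha1.ne')]
    have : Real.log (1 - (a - q) / (1 + a)) = Real.log (1 + q) - Real.log (1 + a) := by
      rw [← Real.log_div hq.ne' ha1.ne']
      congr 1
      field_simp
      ring
    rw [this, show q - a = -(a - q) by ring]
    field_simp

/-- primitive of `(1+2a) D(a,q)/(1+a+q)` -/
noncomputable def Phi (a q : ℝ) : ℝ :=
  -Li2 ((a - q) / (1 + a))
    - (Real.log (1 + q) * (Real.log (1 + a + q) - Real.log a) + Li2 (-((1 + q) / a)))
    + Real.log (1 + a) * Real.log (1 + a + q)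

lemma hasDerivAt_Phi {a q : ℝ} (ha : 0 < a) (hq : 0 ≤ q) :
    HasDerivAt (Phi a) ((1 + 2 * a) * (Dd a q / (1 + a + q))) q := by
  have hq1 : 0 < 1 + q := by linarith
  have hs : 0 < 1 + a + q := by linarith
  have d1 := hasDerivAt_DdInt ha hq1
  have d2 := hasDerivAt_log1 hq1
  have d3 : HasDerivAt (fun q => Real.log (1 + a + q)) (1 / (1 + a + q)) q := by
    have hl : HasDerivAt (fun x : ℝ => 1 + a + x) 1 q := by
      simpa using (hasDerivAt_id q).const_add (1 + a)
    exact hl.log hs.ne'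
  have d4 : HasDerivAt (fun q => -((1 + q) / a)) (-(1 / a)) q := by
    have hl : HasDerivAt (fun x : ℝ => 1 + x) 1 q := by
      simpa using (hasDerivAt_id q).const_add 1
    exact (hl.div_const a).neg
  have hpos : 0 < (1 + q) / a := by positivity
  have d5 := Li2_comp d4 (by linarith)
  have d := (d1.sub ((d2.mul (d3.sub_const (Real.log a))).add d5)).add
    (d3.const_mul (Real.log (1 + a)))
  convert! d using 1
  rw [gker_ne (by linarith)]
  have : Real.log (1 - -((1 + q) / a)) = Real.log (1 + a + q) - Real.log a := by
    rw [← Real.log_div hs.ne' ha.ne']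
    congr 1
    field_simp
    ring
  rw [this]
  have hm := Dd_mul a q
  have e : Real.log (1 + q) = Dd a q * (q - a) + Real.log (1 + a) := by linarith
  rw [e]
  field_simp
  ring

lemma cont_DdOver {a : ℝ} (ha : 0 < a) (n : ℕ) :
    ContinuousOn (fun q => Dd a q / (1 + a + q) ^ n) (Set.Ici 0) := by
  refine ((continuousOn_Dd ha).mono ?_).div (by fun_prop) ?_
  · intro x hx
    have : 0 ≤ x := hx
    show -1 < x
    linarith
  · intro x hx
    have : 0 ≤ x := hx
    positivity

lemma ii_DdOver {a : ℝ} (ha : 0 < a) (n : ℕ) {l : ℝ} (hl : 0 ≤ l) :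
    IntervalIntegrable (fun q => Dd a q / (1 + a + q) ^ n) volume 0 l := by
  refine ((cont_DdOver ha n).mono ?_).intervalIntegrable
  rw [Set.uIcc_of_le hl]
  exact Set.Icc_subset_Ici_self

lemma int_P {a : ℝ} (ha : 0 < a) {l : ℝ} (hl : 0 ≤ l) :
    (∫ q in (0:ℝ)..l, Dd a q / (1 + a + q) ^ 1) = (Phi a l - Phi a 0) / (1 + 2 * a) := by
  have h := intervalIntegral.integral_eq_sub_of_hasDerivAt (a := 0) (b := l) (f := Phi a)
    (f' := fun q => (1 + 2 * a) * (Dd a q / (1 + a + q) ^ 1)) ?_ ?_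
  · rw [intervalIntegral.integral_const_mul] at h
    rw [← h]
    field_simp
  · intro q hq
    rw [Set.uIcc_of_le hl] at hq
    simpa using hasDerivAt_Phi ha hq.1
  · exact (ii_DdOver ha 1 hl).const_mul _

lemma logmul_tendsto (t : ℝ) :
    Tendsto (fun v : ℝ => Real.log v * Real.log (1 + t / v)) atTop (nhds 0) := by
  have h1 := tendsto_mul_log_one_add_div_atTop t
  have h2 : Tendsto (fun v : ℝ => Real.log v / v) atTop (nhds 0) :=
    Real.isLittleO_log_id_atTop.tendsto_div_nhds_zero
  have h3 := h2.mul h1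
  rw [zero_mul] at h3
  refine h3.congr' ?_
  filter_upwards [eventually_gt_atTop 0] with v hv
  field_simp

lemma log_tendsto (t : ℝ) :
    Tendsto (fun v : ℝ => Real.log (1 + t / v)) atTop (nhds 0) := by
  have h : Tendsto (fun v : ℝ => 1 + t / v) atTop (nhds (1 + 0)) :=
    (tendsto_const_nhds.div_atTop tendsto_id).const_add 1
  rw [add_zero] at h
  simpa using h.log one_ne_zero

lemma Phi_zero {a : ℝ} (ha : 0 < a) :
    Phi a 0 = 2 * Li2 (-a) + 3 / 2 * Real.log (1 + a) ^ 2 + π ^ 2 / 6 + Real.log a ^ 2 / 2 := by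
  have h1 := Li2_landen ha
  have h2 := Li2_inv ha
  unfold Phi
  simp only [sub_zero, add_zero, Real.log_one, zero_mul, zero_add, one_div]
  linear_combination -h1 - h2

lemma Li2_tendsto {f : ℝ → ℝ} (hf : Tendsto f atTop (nhds 0)) :
    Tendsto (fun x => Li2 (f x)) atTop (nhds 0) := by
  have h := (hasDerivAt_Li2 (x := 0) (by norm_num)).continuousAt.tendsto.comp hf
  rwa [Li2_zero] at h

lemma Phi_tendsto {a : ℝ} (ha : 0 < a) :
    Tendsto (Phi a) atTop
      (nhds (π ^ 2 / 3 + Real.log (1 + a) ^ 2 / 2 + Real.log a ^ 2 / 2)) := by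
  have hv : Tendsto (fun q : ℝ => 1 + q) atTop atTop := tendsto_atTop_add_const_left _ _ tendsto_id
  have hw : Tendsto (fun q : ℝ => q - a) atTop atTop := tendsto_atTop_add_const_right _ _ tendsto_id
  have e1 := (log_tendsto (-(1 + a))).comp hv
  have e2 := (log_tendsto a).comp hv
  have m1 := (logmul_tendsto (-(1 + a))).comp hv
  have m2 := (logmul_tendsto a).comp hv
  have L1 : Tendsto (fun q : ℝ => Li2 (-((q - a) / (1 + a))⁻¹)) atTop (nhds 0) := by
    apply Li2_tendsto
    rw [← neg_zero]
    exact (tendsto_inv_atTop_zero.comp (hw.atTop_div_const (by linarith))).neg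
  have L2 : Tendsto (fun q : ℝ => Li2 (-((1 + q) / a)⁻¹)) atTop (nhds 0) := by
    apply Li2_tendsto
    rw [← neg_zero]
    exact (tendsto_inv_atTop_zero.comp (hv.atTop_div_const ha)).neg
  have T := (((((((L1.add L2).add_const
    (π ^ 2 / 3 + Real.log (1 + a) ^ 2 / 2 + Real.log a ^ 2 / 2)).add m1).add
    ((e1.pow 2).div_const 2)).sub (e1.mul_const (Real.log (1 + a)))).sub m2).add
    (e2.const_mul (Real.log (1 + a))))
  convert! T.congr' ?_ using 2
  · ring
  · filter_upwards [eventually_gt_atTop a] with q hq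
    have hq1 : 0 < 1 + q := by linarith
    have ha1 : 0 < 1 + a := by linarith
    have hqa : 0 < q - a := by linarith
    have hs : 0 < 1 + a + q := by linarith
    have i1 := Li2_inv (x := (q - a) / (1 + a)) (by positivity)
    have i2 := Li2_inv (x := (1 + q) / a) (by positivity)
    have k1 : Real.log (1 + -(1 + a) / (1 + q)) = Real.log (q - a) - Real.log (1 + q) := by
      rw [← Real.log_div hqa.ne' hq1.ne']
      congr 1
      field_simp
      ring
    have k2 : Real.log (1 + a / (1 + q)) = Real.log (1 + a + q) - Real.log (1 + q) := by
      rw [← Real.log_div hs.ne' hq1.ne']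
      congr 1
      field_simp
      ring
    rw [Real.log_div hqa.ne' ha1.ne'] at i1
    rw [Real.log_div hq1.ne' ha.ne'] at i2
    simp only [Function.comp_apply, Phi, k1, k2]
    rw [show (a - q) / (1 + a) = -((q - a) / (1 + a)) by ring]
    linear_combination i1 + i2

/-- value of `∫₀^∞ D(a,q)/(1+a+q) dq` -/
noncomputable def Pv (a : ℝ) : ℝ :=
  (π ^ 2 / 6 - 2 * Li2 (-a) - Real.log (1 + a) ^ 2) / (1 + 2 * a)

lemma P_tendsto {a : ℝ} (ha : 0 < a) :
    Tendsto (fun l : ℝ => ∫ q in (0:ℝ)..l, Dd a q / (1 + a + q) ^ 1) atTop (nhds (Pv a)) := by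
  have h := ((Phi_tendsto ha).sub_const (Phi a 0)).div_const (1 + 2 * a)
  have e : Pv a = (π ^ 2 / 3 + Real.log (1 + a) ^ 2 / 2 + Real.log a ^ 2 / 2 - Phi a 0)
      / (1 + 2 * a) := by
    rw [Phi_zero ha, Pv]
    ring
  rw [e]
  refine h.congr' ?_
  filter_upwards [eventually_ge_atTop 0] with l hl
  rw [int_P ha hl]

/-- primitive of `(log(1+q) - log(1+a))/(1+a+q)^2` -/
noncomputable def Psi (a q : ℝ) : ℝ :=
  -(Real.log (1 + q) - Real.log (1 + a)) / (1 + a + q)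
    + (Real.log (1 + q) - Real.log (1 + a + q)) / a

lemma hasDerivAt_Psi {a q : ℝ} (ha : 0 < a) (hq : 0 ≤ q) :
    HasDerivAt (Psi a) (Dd a q / (1 + a + q) ^ 1 - (1 + 2 * a) * (Dd a q / (1 + a + q) ^ 2)) q := by
  have hq1 : 0 < 1 + q := by linarith
  have hs : 0 < 1 + a + q := by linarith
  have d2 := hasDerivAt_log1 hq1
  have hl : HasDerivAt (fun x : ℝ => 1 + a + x) 1 q := by
    simpa using (hasDerivAt_id q).const_add (1 + a)
  have d3 : HasDerivAt (fun q => Real.log (1 + a + q)) (1 / (1 + a + q)) q := hl.log hs.ne'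
  have d := ((d2.sub_const (Real.log (1 + a))).neg.div hl hs.ne').add ((d2.sub d3).div_const a)
  convert! d using 1
  simp only [Pi.neg_apply]
  have hm := Dd_mul a q
  have e : Real.log (1 + q) = Dd a q * (q - a) + Real.log (1 + a) := by linarith
  rw [e]
  field_simp
  ring

lemma Psi_tendsto {a : ℝ} (ha : 0 < a) : Tendsto (Psi a) atTop (nhds 0) := by
  have hv : Tendsto (fun q : ℝ => 1 + q) atTop atTop := tendsto_atTop_add_const_left _ _ tendsto_id
  have e2 := (log_tendsto a).comp hv
  have h2 : Tendsto (fun v : ℝ => Real.log v / v) atTop (nhds 0) :=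
    Real.isLittleO_log_id_atTop.tendsto_div_nhds_zero
  have hs : Tendsto (fun q : ℝ => 1 + a + q) atTop atTop :=
    tendsto_atTop_add_const_left _ _ tendsto_id
  have h3 := h2.comp hs
  have h4 := (tendsto_inv_atTop_zero (𝕜 := ℝ)).comp hs
  have T := (((h3.neg.add (e2.mul h4)).add (h4.const_mul (Real.log (1 + a)))).sub
    (e2.div_const a))
  convert! T.congr' ?_ using 2
  · simp
  · filter_upwards [eventually_gt_atTop 0] with q hq
    have hq1 : 0 < 1 + q := by linarith
    have hs : 0 < 1 + a + q := by linarith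
    have k2 : Real.log (1 + a / (1 + q)) = Real.log (1 + a + q) - Real.log (1 + q) := by
      rw [← Real.log_div hs.ne' hq1.ne']
      congr 1
      field_simp
      ring
    simp only [Function.comp_apply, Psi, k2]
    field_simp
    ring

/-- value of `∫₀^∞ D(a,q)/(1+a+q)^2 dq` -/
noncomputable def Qv (a : ℝ) : ℝ :=
  (Pv a - Real.log (1 + a) / (a * (1 + a))) / (1 + 2 * a)

lemma Q_tendsto {a : ℝ} (ha : 0 < a) :
    Tendsto (fun l : ℝ => ∫ q in (0:ℝ)..l, Dd a q / (1 + a + q) ^ 2) atTop (nhds (Qv a)) := by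
  have h := ((P_tendsto ha).sub ((Psi_tendsto ha).sub_const (Psi a 0))).div_const (1 + 2 * a)
  have e : Qv a = (Pv a - (0 - Psi a 0)) / (1 + 2 * a) := by
    simp only [Qv, Psi, add_zero, Real.log_one]
    congr 1
    field_simp
    ring
  rw [e]
  refine h.congr' ?_
  filter_upwards [eventually_ge_atTop 0] with l hl
  have hi := intervalIntegral.integral_eq_sub_of_hasDerivAt (a := 0) (b := l) (f := Psi a)
    (f' := fun q => Dd a q / (1 + a + q) ^ 1 - (1 + 2 * a) * (Dd a q / (1 + a + q) ^ 2)) ?_ ?_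
  · rw [intervalIntegral.integral_sub (ii_DdOver ha 1 hl) ((ii_DdOver ha 2 hl).const_mul _),
      intervalIntegral.integral_const_mul] at hi
    rw [← hi]
    field_simp
    ring
  · intro q hq
    rw [Set.uIcc_of_le hl] at hq
    exact hasDerivAt_Psi ha hq.1
  · exact (ii_DdOver ha 1 hl).sub ((ii_DdOver ha 2 hl).const_mul _)

lemma G2_eq {a q : ℝ} (ha : 0 < a) : G2 a q = 2 * (Dd a q / (1 + a + q) ^ 2) := by
  unfold G2
  split_ifs with h
  · subst h
    rw [Dd_same ha, show 1 + a + a = 1 + 2 * a by ring]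
    field_simp
  · have h1 : a - q ≠ 0 := sub_ne_zero.2 h
    rw [Dd_ne (Ne.symm h), show q - a = -(a - q) by ring]
    by_cases hs : 1 + a + q = 0
    · simp [hs]
    · field_simp
      ring

lemma G2_comm (x y : ℝ) : G2 x y = G2 y x := by
  unfold G2
  by_cases h : x = y
  · subst h; rfl
  · rw [if_neg h, if_neg (Ne.symm h)]
    have h1 : x - y ≠ 0 := sub_ne_zero.2 h
    rw [show y - x = -(x - y) by ring, show 1 + y + x = 1 + x + y by ring, mul_neg, div_neg,
      ← neg_div]
    congr 1
    ring

lemma Dd_comm (x y : ℝ) : Dd x y = Dd y x := by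
  by_cases h : x = y
  · subst h; rfl
  · rw [Dd_ne h, Dd_ne (Ne.symm h), ← neg_sub (Real.log (1 + x)), ← neg_sub x y, neg_div_neg_eq]

/-- the subtracted integral -/
lemma F_eq {a b : ℝ} (ha : 0 < a) (hb : 0 < b) (hab : a ≠ b) {l : ℝ} (hl : 0 ≤ l) :
    (∫ q in (0:ℝ)..l, (G2 a q - G2 a b) / (q - b)) =
      2 / (1 + a + b) ^ 2 * (∫ q in (0:ℝ)..l, (Dd a q - Dd b q) / (a - b))
      - 2 / (1 + a + b) ^ 2 * (∫ q in (0:ℝ)..l, Dd a q / (1 + a + q) ^ 1)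
      - 2 / (1 + a + b) * (∫ q in (0:ℝ)..l, Dd a q / (1 + a + q) ^ 2) := by
  have i0 : ∀ c : ℝ, 0 < c → IntervalIntegrable (fun q => Dd c q) volume 0 l := by
    intro c hc
    simpa using ii_DdOver hc 0 hl
  have i1 : IntervalIntegrable (fun q => (Dd a q - Dd b q) / (a - b)) volume 0 l :=
    ((i0 a ha).sub (i0 b hb)).div_const _
  rw [← intervalIntegral.integral_const_mul, ← intervalIntegral.integral_const_mul,
    ← intervalIntegral.integral_const_mul,
    ← intervalIntegral.integral_sub (i1.const_mul _) ((ii_DdOver ha 1 hl).const_mul _),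
    ← intervalIntegral.integral_sub
      ((i1.const_mul _).sub ((ii_DdOver ha 1 hl).const_mul _)) ((ii_DdOver ha 2 hl).const_mul _)]
  apply intervalIntegral.integral_congr_ae
  filter_upwards [ae_ne a, ae_ne b] with q hqa hqb hq
  rw [Set.uIoc_of_le hl] at hq
  have hq0 := hq.1
  rw [G2_eq ha, G2_eq ha, Dd_ne hqa, Dd_ne hqb, Dd_ne (Ne.symm hab)]
  have h1 : q - a ≠ 0 := sub_ne_zero.2 hqa
  have h2 : q - b ≠ 0 := sub_ne_zero.2 hqb
  have h3 : a - b ≠ 0 := sub_ne_zero.2 hab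
  rw [show b - a = -(a - b) by ring]
  field_simp
  ring

lemma B_tendsto {a b : ℝ} (ha : 0 < a) (hb : 0 < b) :
    Tendsto (fun l : ℝ => ∫ q in (0:ℝ)..l, (G0 q b - G0 a q)) atTop
      (nhds (Real.log (1 + a) - Real.log (1 + b))) := by
  have hv : Tendsto (fun q : ℝ => 1 + a + q) atTop atTop :=
    tendsto_atTop_add_const_left _ _ tendsto_id
  have e := ((log_tendsto (b - a)).comp hv).add_const (Real.log (1 + a) - Real.log (1 + b))
  rw [zero_add] at e
  refine e.congr' ?_
  filter_upwards [eventually_ge_atTop 0] with l hl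
  have hi := intervalIntegral.integral_eq_sub_of_hasDerivAt (a := 0) (b := l)
    (f := fun q => Real.log (1 + b + q) - Real.log (1 + a + q))
    (f' := fun q => G0 q b - G0 a q) ?_ ?_
  · rw [hi]
    have hs : 0 < 1 + a + l := by linarith
    have hs' : 0 < 1 + b + l := by linarith
    have : Real.log (1 + (b - a) / (1 + a + l)) = Real.log (1 + b + l) - Real.log (1 + a + l) := by
      rw [← Real.log_div hs'.ne' hs.ne']
      congr 1
      field_simp
      ring
    simp only [Function.comp_apply, this, add_zero]
    ring
  · intro q hq
    rw [Set.uIcc_of_le hl] at hq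
    have hq0 := hq.1
    have d : ∀ c : ℝ, 0 < c → HasDerivAt (fun q => Real.log (1 + c + q)) (1 / (1 + c + q)) q := by
      intro c hc
      have hl : HasDerivAt (fun x : ℝ => 1 + c + x) 1 q := by
        simpa using (hasDerivAt_id q).const_add (1 + c)
      exact hl.log (by positivity)
    convert! (d b hb).sub (d a ha) using 1
    unfold G0
    rw [show 1 + q + b = 1 + b + q by ring]
  · apply ContinuousOn.intervalIntegrable
    rw [Set.uIcc_of_le hl]
    unfold G0
    refine ContinuousOn.sub ?_ ?_
    · refine ContinuousOn.div (by fun_prop) (by fun_prop) ?_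
      intro x hx
      have := hx.1
      positivity
    · refine ContinuousOn.div (by fun_prop) (by fun_prop) ?_
      intro x hx
      have := hx.1
      positivity

lemma A_eq {a b : ℝ} (ha : 0 < a) (hb : 0 < b) {l : ℝ} (hl : 0 ≤ l) :
    (∫ q in (0:ℝ)..l, (G2 q b - G2 a q)) =
      2 * (∫ q in (0:ℝ)..l, Dd b q / (1 + b + q) ^ 2)
      - 2 * (∫ q in (0:ℝ)..l, Dd a q / (1 + a + q) ^ 2) := by
  rw [← intervalIntegral.integral_const_mul, ← intervalIntegral.integral_const_mul,
    ← intervalIntegral.integral_sub ((ii_DdOver hb 2 hl).const_mul _)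
      ((ii_DdOver ha 2 hl).const_mul _)]
  congr 1
  funext q
  rw [G2_comm q b, G2_eq ha, G2_eq hb]

/-- Fourth-order 2-point function of the 2D noncommutative 3-colour model:
the `n = 2` instance of the recursion, with cutoff `Λ → ∞`, evaluates to the explicit
dilogarithmic expression `G₄(p₁,p₂)`. -/
theorem fourth_order_two_point (p₁ p₂ : ℝ) (hp₁ : 0 < p₁) (hp₂ : 0 < p₂) (hne : p₁ ≠ p₂) :
    Tendsto (fun Λ : ℝ =>
      (1 / ((1 + p₁ + p₂) * (p₁ - p₂))) *
        (3 * (G0 p₁ p₂ * (∫ q in (0:ℝ)..Λ, (G2 q p₂ - G2 p₁ q))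
              + G2 p₁ p₂ * (∫ q in (0:ℝ)..Λ, (G0 q p₂ - G0 p₁ q)))
          - (∫ q in (0:ℝ)..Λ, (G2 p₁ q - G2 p₁ p₂) / (q - p₂))
          + ∫ q in (0:ℝ)..Λ, (G2 p₂ q - G2 p₁ p₂) / (q - p₁)))
      atTop
      (nhds ((2 / ((1 + p₁ + p₂) ^ 2 * (p₁ - p₂))) *
        (3 * (Real.log (1 + p₁) - Real.log (1 + p₂)) ^ 2 / ((1 + p₁ + p₂) * (p₁ - p₂))
          + 2 * Real.log (1 + p₁) / (p₁ * (1 + 2 * p₁) * (1 + p₁))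
          - 2 * Real.log (1 + p₂) / (p₂ * (1 + 2 * p₂) * (1 + p₂))
          - (1 + 2 * p₂) * (π ^ 2 / 6 - 2 * Li2 (-p₁) - Real.log (1 + p₁) ^ 2)
              / ((1 + 2 * p₁) ^ 2 * (1 + p₁ + p₂))
          + (1 + 2 * p₁) * (π ^ 2 / 6 - 2 * Li2 (-p₂) - Real.log (1 + p₂) ^ 2)
              / ((1 + 2 * p₂) ^ 2 * (1 + p₁ + p₂))))) := by
  have P1 := P_tendsto hp₁
  have P2 := P_tendsto hp₂
  have Q1 := Q_tendsto hp₁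
  have Q2 := Q_tendsto hp₂
  have B := B_tendsto hp₁ hp₂
  have hd : p₁ - p₂ ≠ 0 := sub_ne_zero.2 hne
  have T := ((((((Q2.const_mul 2).sub (Q1.const_mul 2)).const_mul (G0 p₁ p₂)).add
    (B.const_mul (G2 p₁ p₂))).const_mul 3).add
    (((P1.sub P2).const_mul (2 / (1 + p₁ + p₂) ^ 2)).add
      ((Q1.sub Q2).const_mul (2 / (1 + p₁ + p₂))))).const_mul
    (1 / ((1 + p₁ + p₂) * (p₁ - p₂)))
  convert! T.congr' ?_ using 2
  · rw [G2, if_neg hne, G0, Qv, Qv, Pv, Pv]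
    field_simp
    ring
  · filter_upwards [eventually_ge_atTop 0] with l hl
    have hsymm : (∫ q in (0:ℝ)..l, (Dd p₂ q - Dd p₁ q) / (p₂ - p₁))
        = ∫ q in (0:ℝ)..l, (Dd p₁ q - Dd p₂ q) / (p₁ - p₂) := by
      congr 1
      funext q
      rw [← neg_sub (Dd p₁ q), ← neg_sub p₁, neg_div_neg_eq]
    rw [A_eq hp₁ hp₂ hl, F_eq hp₁ hp₂ hne hl, G2_comm p₁ p₂, F_eq hp₂ hp₁ hne.symm hl, hsymm,
      show 1 + p₂ + p₁ = 1 + p₁ + p₂ by ring]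
    ring
end

section
/- Planar graph amplitude Γ₁ (sunset-type double integral): for all real p₁, p₂ ≥ 0 with p₁ ≠ p₂, the double integral over [0,∞)² of 1/((1+q₁+q₂)(1+p₁+q₁)(1+p₁+q₂)(1+p₂+q₁)(1+p₂+q₂)) dq₁ dq₂ converges and equals −log²(1+p₁)/((p₁−p₂)²(1+2p₁)) − log²(1+p₂)/((p₁−p₂)²(1+2p₂)) − (π²/6 − 2Li₂(−p₁))/((1+2p₁)(p₁−p₂)(1+p₁+p₂)) + (π²/6 − 2Li₂(−p₂))/((1+2p₂)(p₁−p₂)(1+p₁+p₂)) + 2log(1+p₁)log(1+p₂)/((p₁−p₂)²(1+p₁+p₂)). -/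
open MeasureTheory Real

open Filter Topology Set

/-- `log v / (v - 1)`, continuously extended to `v = 1`. -/
noncomputable def phiAux (v : ℝ) : ℝ := dslope Real.log 1 v

theorem phiAux_of_ne {v : ℝ} (hv : v ≠ 1) : phiAux v = Real.log v / (v - 1) := by
  unfold phiAux
  rw [dslope_of_ne _ hv, slope_def_field]
  simp

theorem phiAux_continuousOn : ContinuousOn phiAux (Ioi 0) := by
  unfold phiAux
  rw [continuousOn_dslope (Ioi_mem_nhds one_pos)]
  refine ⟨fun x hx => (Real.continuousAt_log (ne_of_gt hx)).continuousWithinAt, ?_⟩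
  exact (Real.hasDerivAt_log one_ne_zero).differentiableAt

theorem phiAux_intervalIntegrable {s : ℝ} (hs : 0 ≤ s) : IntervalIntegrable phiAux volume 0 s := by
  have h1 : IntervalIntegrable phiAux volume 0 (1/2) := by
    have h : IntervalIntegrable (fun v => Real.log v * (v - 1)⁻¹) volume 0 (1/2) := by
      refine intervalIntegral.intervalIntegrable_log'.mul_continuousOn ?_
      rw [uIcc_of_le (by norm_num)]
      intro x hx
      have : x - 1 ≠ 0 := by have := hx.2; intro h; linarith
      exact ((continuousAt_id.sub continuousAt_const).inv₀ this).continuousWithinAt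
    refine h.congr ?_
    intro x hx
    rw [uIoc_of_le (by norm_num)] at hx
    have : x ≠ 1 := by have := hx.2; intro h; linarith
    simp only [phiAux_of_ne this, div_eq_mul_inv]
  rcases hs.eq_or_lt with rfl | hs
  · exact IntervalIntegrable.refl
  refine h1.trans ?_
  refine ContinuousOn.intervalIntegrable (phiAux_continuousOn.mono ?_)
  intro x hx
  have := hx.1
  exact lt_of_lt_of_le (lt_min (by norm_num) hs) this

/-- Primitive of `phiAux`. -/
noncomputable def DAux (s : ℝ) : ℝ := ∫ v in (0:ℝ)..s, phiAux v

theorem DAux_hasDerivAt {s : ℝ} (hs : 0 < s) : HasDerivAt DAux (phiAux s) s := by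
  have hc : ContinuousAt phiAux s := phiAux_continuousOn.continuousAt (Ioi_mem_nhds hs)
  refine intervalIntegral.integral_hasDerivAt_right (phiAux_intervalIntegrable hs.le) ?_ hc
  exact phiAux_continuousOn.stronglyMeasurableAtFilter isOpen_Ioi s hs

theorem DAux_tendsto_zero : Tendsto DAux (𝓝[>] 0) (𝓝 0) := by
  have h : ContinuousOn DAux (uIcc 0 1) :=
    intervalIntegral.continuousOn_primitive_interval
      (by rw [uIcc_of_le zero_le_one, integrableOn_Icc_iff_integrableOn_Ioc]
          exact (phiAux_intervalIntegrable zero_le_one).1)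
  have h0 : ContinuousWithinAt DAux (uIcc 0 1) 0 := h 0 left_mem_uIcc
  have hD : DAux 0 = 0 := by simp [DAux]
  unfold ContinuousWithinAt at h0
  rw [hD] at h0
  refine h0.mono_left ?_
  rw [← nhdsWithin_Ioc_eq_nhdsGT (zero_lt_one' ℝ), uIcc_of_le zero_le_one]
  exact nhdsWithin_mono _ Ioc_subset_Icc_self

theorem integral_pow_log (n : ℕ) :
    IntervalIntegrable (fun v : ℝ => - (v ^ n * Real.log v)) volume 0 1 ∧
    ∫ v in (0:ℝ)..1, - (v ^ n * Real.log v) = 1 / ((n + 1 : ℕ) : ℝ) ^ 2 := by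
  have hI : IntervalIntegrable (fun v : ℝ => - (v ^ n * Real.log v)) volume 0 1 :=
    (intervalIntegral.intervalIntegrable_log'.continuousOn_mul (by fun_prop)).neg
  refine ⟨hI, ?_⟩
  have hn : ((n + 1 : ℕ) : ℝ) ≠ 0 := by positivity
  rw [intervalIntegral.integral_eq_sub_of_hasDerivAt_of_le zero_le_one
    (f := fun v : ℝ => v ^ (n+1) / ((n + 1 : ℕ) : ℝ) ^ 2 - v ^ n * (v * Real.log v) / ((n + 1 : ℕ) : ℝ))
    _ _ hI]
  · simp
  · have := Real.continuous_mul_log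
    exact Continuous.continuousOn (by fun_prop)
  · intro x hx
    have hx0 : x ≠ 0 := ne_of_gt hx.1
    have h1 := ((hasDerivAt_pow (n+1) x).div_const (((n + 1 : ℕ) : ℝ) ^ 2)).sub
      (((hasDerivAt_pow (n+1) x).mul (Real.hasDerivAt_log hx0)).div_const ((n + 1 : ℕ) : ℝ))
    convert! h1 using 1
    · funext v
      simp only [Pi.sub_apply, Pi.mul_apply]
      ring
    · simp only [Nat.add_sub_cancel]
      push_cast at hn ⊢
      field_simp
      ring

theorem DAux_one : DAux 1 = π ^ 2 / 6 := by
  have key := hasSum_integral_of_summable_integral_norm (μ := volume.restrict (Ioc (0:ℝ) 1))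
    (F := fun (n : ℕ) (v : ℝ) => - (v ^ n * Real.log v))
    (fun n => (integral_pow_log n).1.1) ?_
  · have e1 : ∀ n : ℕ, ∫ v in Ioc (0:ℝ) 1, - (v ^ n * Real.log v) = 1 / ((n + 1 : ℕ) : ℝ) ^ 2 := by
      intro n
      rw [← (integral_pow_log n).2, intervalIntegral.integral_of_le zero_le_one]
    simp only [e1] at key
    have h2 : HasSum (fun n : ℕ => 1 / ((n + 1 : ℕ) : ℝ) ^ 2) (π ^ 2 / 6) := by
      have := (hasSum_nat_add_iff' (f := fun n : ℕ => 1 / (n : ℝ) ^ 2) 1).2 hasSum_zeta_two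
      simpa using this
    rw [← key.unique h2]
    unfold DAux
    rw [intervalIntegral.integral_of_le zero_le_one, integral_Ioc_eq_integral_Ioo,
      integral_Ioc_eq_integral_Ioo]
    refine setIntegral_congr_fun measurableSet_Ioo ?_
    intro v hv
    have h1 : v ≠ 1 := ne_of_lt hv.2
    have h3 : (1 - v) ≠ 0 := sub_ne_zero.2 h1.symm
    have h4 : (v - 1) ≠ 0 := sub_ne_zero.2 h1
    simp only [phiAux_of_ne h1]
    rw [tsum_neg, tsum_mul_right, tsum_geometric_of_lt_one hv.1.le hv.2]
    field_simp
    ring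
  · have e1 : ∀ n : ℕ, ∫ v in Ioc (0:ℝ) 1, ‖- (v ^ n * Real.log v)‖ = 1 / ((n + 1 : ℕ) : ℝ) ^ 2 := by
      intro n
      rw [← (integral_pow_log n).2, intervalIntegral.integral_of_le zero_le_one]
      refine setIntegral_congr_fun measurableSet_Ioc ?_
      intro v hv
      simp only
      rw [Real.norm_of_nonneg]
      have := Real.log_nonpos hv.1.le hv.2
      have := pow_nonneg hv.1.le n
      nlinarith
    simp only [e1]
    exact (summable_nat_add_iff 1 (f := fun n : ℕ => 1 / (n : ℝ) ^ 2)).2 hasSum_zeta_two.summable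

theorem Li2_neg_eq {q : ℝ} (hq : 0 ≤ q) : DAux (1 + q) = π ^ 2 / 6 - Li2 (-q) := by
  have h : DAux (1 + q) - DAux 1 = ∫ v in (1:ℝ)..(1+q), phiAux v :=
    intervalIntegral.integral_interval_sub_left (phiAux_intervalIntegrable (by linarith))
      (phiAux_intervalIntegrable zero_le_one)
  have h2 : ∫ v in (1:ℝ)..(1+q), phiAux v = ∫ w in (0:ℝ)..q, phiAux (1 + w) := by
    rw [intervalIntegral.integral_comp_add_left (fun v => phiAux v)]
    simp
  have h3 : Li2 (-q) = - ∫ w in (0:ℝ)..q, phiAux (1 + w) := by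
    unfold Li2
    have : ∫ w in (0:ℝ)..q, phiAux (1 + w) = ∫ w in (0:ℝ)..q, - (Real.log (1 - (-w)) / (-w)) := by
      rw [intervalIntegral.integral_of_le hq, intervalIntegral.integral_of_le hq]
      refine setIntegral_congr_fun measurableSet_Ioc ?_
      intro w hw
      have : w ≠ 0 := ne_of_gt hw.1
      simp only
      rw [phiAux_of_ne (by simpa using this)]
      simp [div_neg]
    rw [this, intervalIntegral.integral_neg,
      intervalIntegral.integral_comp_neg (fun u => Real.log (1 - u) / u),
      intervalIntegral.integral_symm]
    simp
  rw [h3, ← h2, ← h, DAux_one]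
  ring

/-- Antiderivative of the outer integrand in the variable `u = 1/(1+x)`. -/
noncomputable def HAux (p b u : ℝ) : ℝ :=
  DAux (b * u) - Real.log (b * u) * Real.log (1 + p * u) + (DAux (1 + p * u) - DAux 1)

theorem HAux_hasDerivAt {p b u : ℝ} (hp : 0 ≤ p) (hb : 0 < b) (hu : 0 < u) :
    HasDerivAt (HAux p b) (b * phiAux (b * u) - Real.log (b * u) * (p / (1 + p * u))) u := by
  have hbu : 0 < b * u := by positivity
  have hpu : 0 < 1 + p * u := by positivity
  have l1 : HasDerivAt (fun u => b * u) b u := by simpa using (hasDerivAt_id u).const_mul b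
  have l2 : HasDerivAt (fun u => 1 + p * u) p u := by
    simpa using ((hasDerivAt_id u).const_mul p).const_add 1
  have d1 := (DAux_hasDerivAt hbu).comp u l1
  have d2 := (DAux_hasDerivAt hpu).comp u l2
  have d3 := (l1.log hbu.ne').mul (l2.log hpu.ne')
  have := (d1.sub d3).add (d2.sub_const (DAux 1))
  convert! this using 1
  have hφ : phiAux (1 + p * u) * p = Real.log (1 + p * u) / u := by
    rcases hp.eq_or_lt with rfl | hp
    · simp
    · have : 1 + p * u ≠ 1 := by have : 0 < p * u := by positivity
                                 linarith
      rw [phiAux_of_ne this]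
      field_simp
      ring
  rw [hφ]
  field_simp
  ring

theorem HAux_tendsto {p b : ℝ} (hp : 0 ≤ p) (hb : 0 < b) :
    Tendsto (HAux p b) (𝓝[>] 0) (𝓝 0) := by
  have t1 : Tendsto (fun u => b * u) (𝓝[>] 0) (𝓝[>] 0) := by
    refine tendsto_nhdsWithin_iff.2 ⟨?_, ?_⟩
    · have : Tendsto (fun u : ℝ => b * u) (𝓝 0) (𝓝 (b * 0)) := (continuous_const_mul b).tendsto 0
      rw [mul_zero] at this
      exact this.mono_left nhdsWithin_le_nhds
    · filter_upwards [self_mem_nhdsWithin] with u hu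
      exact mul_pos hb hu
  have h1 := DAux_tendsto_zero.comp t1
  have h3 : Tendsto (fun u => DAux (1 + p * u) - DAux 1) (𝓝[>] 0) (𝓝 0) := by
    have c : ContinuousAt DAux 1 := (DAux_hasDerivAt one_pos).continuousAt
    have l : Tendsto (fun u : ℝ => 1 + p * u) (𝓝[>] 0) (𝓝 1) := by
      have : Continuous (fun u : ℝ => 1 + p * u) := by fun_prop
      have := this.tendsto 0
      simp only [mul_zero, add_zero] at this
      exact this.mono_left nhdsWithin_le_nhds
    have := (c.tendsto.comp l).sub_const (DAux 1)
    simpa using this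
  have h2 : Tendsto (fun u => Real.log (b * u) * Real.log (1 + p * u)) (𝓝[>] 0) (𝓝 0) := by
    have h : Tendsto (fun u => |(b * u) * Real.log (b * u)| * (p / b)) (𝓝[>] 0) (𝓝 0) := by
      have := (Real.continuous_mul_log.tendsto 0).comp (t1.mono_right nhdsWithin_le_nhds)
      have := (this.abs).mul_const (p / b)
      simpa using this
    refine squeeze_zero_norm' ?_ h
    filter_upwards [self_mem_nhdsWithin] with u hu
    have hu : 0 < u := hu
    have hpu : 0 ≤ p * u := by positivity
    rw [Real.norm_eq_abs, abs_mul, abs_mul, abs_of_pos (mul_pos hb hu),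
      abs_of_nonneg (Real.log_nonneg (by linarith : 1 ≤ 1 + p * u))]
    have hl : Real.log (1 + p * u) ≤ p * u := by
      have := Real.log_le_sub_one_of_pos (by linarith : 0 < 1 + p * u)
      linarith
    calc _ ≤ |Real.log (b * u)| * (p * u) := by gcongr
      _ = _ := by field_simp
  have := (h1.sub h2).add h3
  rw [sub_zero, add_zero] at this
  exact this

/-- The elementary kernel. -/
noncomputable def KAux (a b : ℝ) (z : ℝ × ℝ) : ℝ := 1 / ((1 + z.1 + z.2) * (a + z.1) * (b + z.2))

theorem KAux_integrable {a b : ℝ} (ha : 1 ≤ a) (hb : 1 ≤ b) :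
    IntegrableOn (KAux a b) (Ioi 0 ×ˢ Ioi 0) := by
  have h1 : IntegrableOn (fun x : ℝ => (x + 1) ^ (-(3/2) : ℝ)) (Ioi 0) :=
    integrableOn_add_rpow_Ioi_of_lt (by norm_num) (by norm_num)
  have h2 := Integrable.mul_prod h1 h1
  unfold IntegrableOn
  rw [Measure.volume_eq_prod, ← Measure.prod_restrict]
  refine h2.mono' ?_ ?_
  · refine Measurable.aestronglyMeasurable ?_
    unfold KAux
    fun_prop
  · rw [Measure.prod_restrict]
    refine (ae_restrict_iff' (measurableSet_Ioi.prod measurableSet_Ioi)).2 (ae_of_all _ ?_)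
    rintro ⟨x, y⟩ ⟨hx, hy⟩
    simp only [mem_Ioi] at hx hy
    simp only [KAux]
    rw [Real.norm_of_nonneg (by positivity)]
    have e : ∀ x : ℝ, 0 < x → (x + 1) ^ (-(3/2) : ℝ) = 1 / (√(x + 1) * (x + 1)) := by
      intro x hx
      rw [Real.rpow_neg (by positivity), show (3/2 : ℝ) = 1/2 + 1 by norm_num,
        Real.rpow_add (by positivity), Real.rpow_one, Real.sqrt_eq_rpow, ← one_div]
    rw [e x hx, e y hy, div_mul_div_comm, one_mul]
    refine one_div_le_one_div_of_le (by positivity) ?_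
    have hs : √(x+1) * √(y+1) ≤ 1 + x + y := by
      rw [← Real.sqrt_mul (by positivity)]
      refine Real.sqrt_le_iff.2 ⟨by positivity, ?_⟩
      nlinarith [mul_pos hx hy]
    calc √(x + 1) * (x + 1) * (√(y + 1) * (y + 1)) 
        = (√(x+1) * √(y+1)) * (x + 1) * (y + 1) := by ring
      _ ≤ (1 + x + y) * (x + a) * (y + b) := by gcongr
      _ = (1 + x + y) * (a + x) * (b + y) := by ring

theorem inner_integral {c b : ℝ} (hc : 0 < c) (hb : 0 < b) (hne : c ≠ b) :
    ∫ y in Ioi (0:ℝ), 1 / ((c + y) * (b + y)) = Real.log (c / b) / (c - b) := by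
  have hcb : c - b ≠ 0 := sub_ne_zero.2 hne
  have := integral_Ioi_of_hasDerivAt_of_nonneg' (a := (0:ℝ)) (l := 0)
    (g := fun y => Real.log ((b + y) / (c + y)) / (c - b))
    (g' := fun y => 1 / ((c + y) * (b + y))) ?_ ?_ ?_
  · rw [this]
    simp only [add_zero]
    rw [← inv_div c b, Real.log_inv]
    ring
  · intro y hy
    have hy : 0 ≤ y := hy
    have h1 : 0 < b + y := by positivity
    have h2 : 0 < c + y := by positivity
    have := ((((hasDerivAt_id y).const_add b).div ((hasDerivAt_id y).const_add c) h2.ne').log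
      (div_pos h1 h2).ne').div_const (c - b)
    convert! this using 1
    simp only [id, Pi.div_apply]
    field_simp
    ring
  · intro y hy
    have hy : 0 < y := hy
    positivity
  · have h : Tendsto (fun y : ℝ => (b + y) / (c + y)) atTop (𝓝 1) := by
      have h1 : Tendsto (fun y : ℝ => 1 + (b - c) / (c + y)) atTop (𝓝 (1 + 0)) :=
        (Tendsto.div_atTop tendsto_const_nhds (tendsto_atTop_add_const_left _ c tendsto_id)).const_add 1
      rw [add_zero] at h1
      refine h1.congr' ?_
      filter_upwards [eventually_gt_atTop 0] with y hy
      have h2 : 0 < c + y := by positivity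
      field_simp
      ring
    have := ((Real.continuousAt_log one_ne_zero).tendsto.comp h).div_const (c - b)
    simpa [Function.comp_def] using this

theorem KAux_integral {p q : ℝ} (hp : 0 ≤ p) (hq : 0 ≤ q) :
    ∫ z in Ioi (0:ℝ) ×ˢ Ioi (0:ℝ), KAux (1 + p) (1 + q) z =
      (π ^ 2 / 6 - Li2 (-p) - Li2 (-q) - Real.log (1 + p) * Real.log (1 + q)) / (1 + p + q) := by
  have hK := KAux_integrable (a := 1 + p) (b := 1 + q) (by linarith) (by linarith)
  have hpq : 1 + p + q ≠ 0 := by positivity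
  set g : ℝ → ℝ := fun x => - (HAux p (1 + q) (1 + x)⁻¹ / (1 + p + q)) with hg
  set g' : ℝ → ℝ := fun x => - (((1 + q) * phiAux ((1 + q) * (1 + x)⁻¹)
    - Real.log ((1 + q) * (1 + x)⁻¹) * (p / (1 + p * (1 + x)⁻¹))) * (-1 / (1 + x) ^ 2) / (1 + p + q))
    with hg'
  have hae : (fun x => ∫ y in Ioi (0:ℝ), KAux (1 + p) (1 + q) (x, y)) =ᵐ[volume.restrict (Ioi 0)] g' := by
    have hne : ∀ᵐ x : ℝ ∂(volume.restrict (Ioi 0)), x ≠ q := by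
      refine ae_restrict_of_ae ?_
      exact Measure.ae_ne volume q
    filter_upwards [hne, ae_restrict_mem measurableSet_Ioi] with x hx hx0
    have hx0 : 0 < x := hx0
    have hxq : x - q ≠ 0 := sub_ne_zero.2 hx
    have hqx : q - x ≠ 0 := sub_ne_zero.2 hx.symm
    have e : ∀ y, KAux (1 + p) (1 + q) (x, y) = (1 + p + x)⁻¹ * (1 / ((1 + x + y) * (1 + q + y))) := by
      intro y
      simp only [KAux, one_div, mul_inv]
      ring
    simp only [e]
    rw [integral_const_mul, inner_integral (by positivity) (by positivity)
      (by intro h; apply hx; linarith)]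
    simp only [hg']
    have h1x : 0 < 1 + x := by positivity
    have hv : (1 + q) * (1 + x)⁻¹ ≠ 1 := by
      rw [← div_eq_mul_inv, Ne, div_eq_one_iff_eq h1x.ne']
      intro h; apply hx; linarith
    rw [phiAux_of_ne hv, show (1 + x) / (1 + q) = ((1 + q) * (1 + x)⁻¹)⁻¹ by rw [mul_inv, inv_inv]; ring,
      Real.log_inv]
    generalize Real.log ((1 + q) * (1 + x)⁻¹) = L
    have e1 : (1 + q) * (1 + x)⁻¹ - 1 = (q - x) / (1 + x) := by field_simp; ring
    have e2 : 1 + p * (1 + x)⁻¹ = (1 + p + x) / (1 + x) := by field_simp; ring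
    have e3 : 1 + x - (1 + q) = -(q - x) := by ring
    have e4 : 1 + p + x ≠ 0 := by positivity
    rw [e1, e2, e3]
    field_simp
    ring
  have hint : Integrable (fun x => ∫ y in Ioi (0:ℝ), KAux (1 + p) (1 + q) (x, y))
      (volume.restrict (Ioi 0)) := by
    have h := hK
    unfold IntegrableOn at h
    rw [Measure.volume_eq_prod, ← Measure.prod_restrict] at h
    exact h.integral_prod_left
  rw [Measure.volume_eq_prod, setIntegral_prod _ (by rw [← Measure.volume_eq_prod]; exact hK),
    integral_congr_ae hae]
  have hd : ∀ x ∈ Ici (0:ℝ), HasDerivAt g (g' x) x := by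
    intro x hx
    have hx : 0 ≤ x := hx
    have h1x : 0 < 1 + x := by positivity
    have i := ((hasDerivAt_id x).const_add 1).inv h1x.ne'
    have := (((HAux_hasDerivAt hp (by positivity : 0 < 1 + q) (inv_pos.2 h1x)).comp x i).div_const
      (1 + p + q)).neg
    exact this
  have ht : Tendsto g atTop (𝓝 0) := by
    have t : Tendsto (fun x : ℝ => (1 + x)⁻¹) atTop (𝓝[>] 0) :=
      tendsto_inv_atTop_nhdsGT_zero.comp (tendsto_atTop_add_const_left _ 1 tendsto_id)
    have := (((HAux_tendsto hp (by positivity : 0 < 1 + q)).comp t).div_const (1 + p + q)).neg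
    simpa [hg, Function.comp_def] using this
  rw [integral_Ioi_of_hasDerivAt_of_tendsto' hd (hint.congr hae) ht]
  simp only [hg, HAux, add_zero, inv_one, mul_one]
  rw [Li2_neg_eq hp, Li2_neg_eq hq, DAux_one]
  ring

/-- Planar graph amplitude `Γ₁` (sunset-type double integral). -/
theorem graph_amplitude_Gamma1 (p₁ p₂ : ℝ) (hp₁ : 0 ≤ p₁) (hp₂ : 0 ≤ p₂) (hne : p₁ ≠ p₂) :
    IntegrableOn
      (fun q : ℝ × ℝ => 1 / ((1 + q.1 + q.2) * (1 + p₁ + q.1) * (1 + p₁ + q.2)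
        * (1 + p₂ + q.1) * (1 + p₂ + q.2)))
      (Set.Ici 0 ×ˢ Set.Ici 0) ∧
    ∫ q in (Set.Ici (0:ℝ) ×ˢ Set.Ici (0:ℝ)),
        1 / ((1 + q.1 + q.2) * (1 + p₁ + q.1) * (1 + p₁ + q.2)
          * (1 + p₂ + q.1) * (1 + p₂ + q.2))
      = -Real.log (1 + p₁) ^ 2 / ((p₁ - p₂) ^ 2 * (1 + 2 * p₁))
        - Real.log (1 + p₂) ^ 2 / ((p₁ - p₂) ^ 2 * (1 + 2 * p₂))
        - (π ^ 2 / 6 - 2 * Li2 (-p₁)) / ((1 + 2 * p₁) * (p₁ - p₂) * (1 + p₁ + p₂))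
        + (π ^ 2 / 6 - 2 * Li2 (-p₂)) / ((1 + 2 * p₂) * (p₁ - p₂) * (1 + p₁ + p₂))
        + 2 * Real.log (1 + p₁) * Real.log (1 + p₂) / ((p₁ - p₂) ^ 2 * (1 + p₁ + p₂)) := by
  have hset : (Ici (0:ℝ) ×ˢ Ici (0:ℝ)) =ᵐ[volume] (Ioi (0:ℝ) ×ˢ Ioi (0:ℝ)) := by
    rw [Measure.volume_eq_prod]
    exact (Measure.set_prod_ae_eq Ioi_ae_eq_Ici Ioi_ae_eq_Ici).symm
  have hd : p₁ - p₂ ≠ 0 := sub_ne_zero.2 hne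
  have i11 := KAux_integrable (a := 1 + p₁) (b := 1 + p₁) (by linarith) (by linarith)
  have i12 := KAux_integrable (a := 1 + p₁) (b := 1 + p₂) (by linarith) (by linarith)
  have i21 := KAux_integrable (a := 1 + p₂) (b := 1 + p₁) (by linarith) (by linarith)
  have i22 := KAux_integrable (a := 1 + p₂) (b := 1 + p₂) (by linarith) (by linarith)
  have hm : MeasurableSet (Ioi (0:ℝ) ×ˢ Ioi (0:ℝ)) := measurableSet_Ioi.prod measurableSet_Ioi
  have hEq : EqOn (fun z : ℝ × ℝ => ((p₁ - p₂) ^ 2)⁻¹ * (KAux (1 + p₁) (1 + p₁) z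
      - KAux (1 + p₁) (1 + p₂) z - KAux (1 + p₂) (1 + p₁) z + KAux (1 + p₂) (1 + p₂) z))
      (fun q : ℝ × ℝ => 1 / ((1 + q.1 + q.2) * (1 + p₁ + q.1) * (1 + p₁ + q.2)
        * (1 + p₂ + q.1) * (1 + p₂ + q.2))) (Ioi (0:ℝ) ×ˢ Ioi (0:ℝ)) := by
    rintro ⟨x, y⟩ ⟨hx, hy⟩
    simp only [mem_Ioi] at hx hy
    simp only [KAux]
    have : 0 < 1 + x + y := by positivity
    have : 0 < 1 + p₁ + x := by positivity
    have : 0 < 1 + p₁ + y := by positivity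
    have : 0 < 1 + p₂ + x := by positivity
    have : 0 < 1 + p₂ + y := by positivity
    field_simp
    ring
  have hI := ((((i11.sub i12).sub i21).add i22).const_mul (((p₁ - p₂) ^ 2)⁻¹))
  have hsplit : ∫ z in Ioi (0:ℝ) ×ˢ Ioi (0:ℝ), (KAux (1 + p₁) (1 + p₁) z
      - KAux (1 + p₁) (1 + p₂) z - KAux (1 + p₂) (1 + p₁) z + KAux (1 + p₂) (1 + p₂) z)
      = (∫ z in Ioi (0:ℝ) ×ˢ Ioi (0:ℝ), KAux (1 + p₁) (1 + p₁) z)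
      - (∫ z in Ioi (0:ℝ) ×ˢ Ioi (0:ℝ), KAux (1 + p₁) (1 + p₂) z)
      - (∫ z in Ioi (0:ℝ) ×ˢ Ioi (0:ℝ), KAux (1 + p₂) (1 + p₁) z)
      + (∫ z in Ioi (0:ℝ) ×ˢ Ioi (0:ℝ), KAux (1 + p₂) (1 + p₂) z) := by
    have s1 := integral_add ((i11.sub i12).sub i21) i22
    have s2 := integral_sub (i11.sub i12) i21
    have s3 := integral_sub i11 i12
    simp only [Pi.sub_apply] at s1 s2 s3
    rw [s1, s2, s3]
  constructor
  · rw [integrableOn_congr_set_ae hset]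
    exact IntegrableOn.congr_fun hI hEq hm
  · rw [setIntegral_congr_set hset, ← setIntegral_congr_fun hm hEq, integral_const_mul, hsplit, KAux_integral hp₁ hp₁, KAux_integral hp₁ hp₂, KAux_integral hp₂ hp₁,
      KAux_integral hp₂ hp₂]
    have h1 : 1 + p₁ + p₁ ≠ 0 := by positivity
    have h2 : 1 + p₂ + p₂ ≠ 0 := by positivity
    have h3 : 1 + p₁ + p₂ ≠ 0 := by positivity
    rw [show 1 + p₂ + p₁ = 1 + p₁ + p₂ by ring, show 1 + p₁ + p₁ = 1 + 2 * p₁ by ring,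
      show 1 + p₂ + p₂ = 1 + 2 * p₂ by ring]
    have h1 : 1 + 2 * p₁ ≠ 0 := by positivity
    have h2 : 1 + 2 * p₂ ≠ 0 := by positivity
    field_simp
    ring
end

section
/- Planar graph amplitude Γ₃: for all real p₁ > 0 and p₂ ≥ 0 with p₁ ≠ p₂, the double integral over [0,∞)² of 1/((1+q₁+q₂)(1+p₁+q₁)²(1+p₁+q₂)(1+p₂+q₁)) dq₁ dq₂ converges and equals −Li₂(−p₁)/((1+2p₁)²(1+p₁+p₂)) − (π²/6 − log²(1+p₁) − Li₂(−p₁))/((1+2p₁)(p₁−p₂)²) − (π²/6 − log²(1+p₁) − Li₂(−p₁))/((1+2p₁)²(p₁−p₂)) + (π²/6 − log(1+p₂)log(1+p₁) − Li₂(−p₂))/((1+p₁+p₂)(p₁−p₂)²) + log(1+p₁)/(p₁(1+p₁)(1+2p₁)(p₁−p₂)). -/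
open MeasureTheory Real

namespace G3

/-- continuous extension of `-log(1-x)/x`. -/
noncomputable def ell (x : ℝ) : ℝ := if x = 0 then 1 else -Real.log (1 - x) / x

lemma ell_ne {x : ℝ} (h : x ≠ 0) : ell x = -Real.log (1 - x) / x := by simp [ell, h]

lemma hasDerivAt_nl {x : ℝ} (hx : x < 1) :
    HasDerivAt (fun x : ℝ => -Real.log (1 - x)) (1 / (1 - x)) x := by
  have h := (((hasDerivAt_id x).const_sub 1).log (by simp; linarith)).neg
  refine h.congr_deriv ?_
  rw [neg_div, neg_neg]; rfl

lemma ell_eq : ell = dslope (fun x : ℝ => -Real.log (1 - x)) 0 := by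
  funext x
  by_cases h : x = 0
  · subst h
    rw [dslope_same, (hasDerivAt_nl (by norm_num : (0:ℝ) < 1)).deriv]
    simp [ell]
  · rw [dslope_of_ne _ h, ell_ne h, slope_def_field]
    simp

lemma ell_cont {x : ℝ} (hx : x < 1) : ContinuousAt ell x := by
  rw [ell_eq]
  by_cases h : x = 0
  · subst h
    rw [continuousAt_dslope_same]
    exact (hasDerivAt_nl hx).differentiableAt
  · rw [continuousAt_dslope_of_ne h]
    exact (hasDerivAt_nl hx).continuousAt

lemma Li2_eq (x : ℝ) : Li2 x = ∫ u in (0:ℝ)..x, ell u := by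
  rw [Li2, ← intervalIntegral.integral_neg]
  apply intervalIntegral.integral_congr_ae
  filter_upwards [Measure.ae_ne volume (0:ℝ)] with u hu _
  rw [ell_ne hu, neg_div]

lemma Li2_deriv {x : ℝ} (hx : x < 1) : HasDerivAt Li2 (ell x) x := by
  have e : Li2 = fun x => ∫ u in (0:ℝ)..x, ell u := funext Li2_eq
  rw [e]
  have hc : ContinuousOn ell (Set.Iio 1) := fun y hy => (ell_cont hy).continuousWithinAt
  apply intervalIntegral.integral_hasDerivAt_right
  · apply ContinuousOn.intervalIntegrable
    apply hc.mono
    intro y hy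
    have := hy.2
    exact lt_of_le_of_lt this (max_lt (by norm_num) hx)
  · exact hc.stronglyMeasurableAtFilter isOpen_Iio x hx
  · exact ell_cont hx

lemma Li2_comp {f : ℝ → ℝ} {f' x : ℝ} (hf : HasDerivAt f f' x) (h : f x < 1) :
    HasDerivAt (fun y => Li2 (f y)) (ell (f x) * f') x :=
  HasDerivAt.comp (h₂ := Li2) (h := f) x (Li2_deriv h) hf

lemma Li2_zero : Li2 0 = 0 := by simp [Li2]

lemma altsum : HasSum (fun n : ℕ => (-1:ℝ)^n / ((n:ℝ)+1)^2) (π^2/12) := by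
  have h0 : HasSum (fun n : ℕ => 1 / ((n:ℝ)+1)^2) (π^2/6) := by
    have := (hasSum_nat_add_iff' 1).2 hasSum_zeta_two
    simpa using this
  have hB : HasSum (fun n : ℕ => 1 / (((2*n+1 : ℕ):ℝ)+1)^2) (π^2/24) := by
    have := h0.mul_left (1/4)
    have e : (fun n : ℕ => 1 / (((2*n+1 : ℕ):ℝ)+1)^2) = fun n : ℕ => 1/4 * (1 / ((n:ℝ)+1)^2) := by
      funext n
      push_cast
      have : (n:ℝ)+1 ≠ 0 := by positivity
      have h2 : 2*(n:ℝ)+1+1 ≠ 0 := by positivity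
      field_simp
      ring
    have e2 : π^2/24 = 1/4 * (π^2/6) := by ring
    rw [e, e2]
    exact this
  have hA' : Summable (fun n : ℕ => 1 / (((2*n : ℕ):ℝ)+1)^2) :=
    h0.summable.comp_injective (i := fun n : ℕ => 2*n) (fun a b h => by simpa using h)
  have hA := hA'.hasSum
  have hAv := (HasSum.even_add_odd (f := fun n : ℕ => 1 / ((n:ℝ)+1)^2) hA hB).unique h0
  have := HasSum.even_add_odd (f := fun n : ℕ => (-1:ℝ)^n / ((n:ℝ)+1)^2)
    (m := ∑' n : ℕ, 1 / (((2*n : ℕ):ℝ)+1)^2) (m' := -(π^2/24))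
    (by simpa [pow_mul] using hA) (by simpa [pow_succ, pow_mul, neg_div] using hB.neg)
  have e : π^2/12 = ∑' n : ℕ, 1 / (((2*n : ℕ):ℝ)+1)^2 + -(π^2/24) := by linarith
  rw [e]
  exact this

lemma Li2_neg_one : Li2 (-1) = -(π^2/12) := by
  let F : ℕ → ℝ → ℝ := fun n t => (-1)^n * t^n / ((n:ℝ)+1)
  have hFint : ∀ n, Integrable (F n) (volume.restrict (Set.Ioc (0:ℝ) 1)) := by
    intro n
    have : Continuous (F n) := by fun_prop
    exact (intervalIntegrable_iff_integrableOn_Ioc_of_le zero_le_one).1 (this.intervalIntegrable 0 1)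
  have hnorm : ∀ n, ∫ t in Set.Ioc (0:ℝ) 1, ‖F n t‖ = 1 / ((n:ℝ)+1)^2 := by
    intro n
    have : ∫ t in Set.Ioc (0:ℝ) 1, ‖F n t‖ = ∫ t in Set.Ioc (0:ℝ) 1, t^n / ((n:ℝ)+1) := by
      apply setIntegral_congr_fun measurableSet_Ioc
      intro t ht
      have h1 : |(n:ℝ)+1| = (n:ℝ)+1 := abs_of_pos (by positivity)
      simp [F, abs_of_pos ht.1, h1]
    rw [this, ← intervalIntegral.integral_of_le zero_le_one, intervalIntegral.integral_div, integral_pow]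
    simp
    field_simp
  have hval : ∀ n, ∫ t in Set.Ioc (0:ℝ) 1, F n t = (-1)^n / ((n:ℝ)+1)^2 := by
    intro n
    rw [← intervalIntegral.integral_of_le zero_le_one, intervalIntegral.integral_div,
      intervalIntegral.integral_const_mul, integral_pow]
    simp
    field_simp
  have hs0 : Summable (fun n : ℕ => 1 / ((n:ℝ)+1)^2) := by
    have := (hasSum_nat_add_iff' 1).2 hasSum_zeta_two
    simpa using this.summable
  have key := hasSum_integral_of_summable_integral_norm hFint (by simpa only [hnorm] using hs0)
  simp only [hval] at key
  have h1 := key.unique altsum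
  have h2 : ∫ t in Set.Ioc (0:ℝ) 1, ∑' n, F n t = ∫ t in Set.Ioc (0:ℝ) 1, ell (-t) := by
    apply setIntegral_congr_ae measurableSet_Ioc
    filter_upwards [Measure.ae_ne volume (1:ℝ)] with t ht1 ht
    have hlt : t < 1 := lt_of_le_of_ne ht.2 ht1
    have hs := Real.hasSum_pow_div_log_of_abs_lt_one (x := -t) (by rw [abs_neg, abs_of_pos ht.1]; exact hlt)
    have hs2 := hs.div_const (-t)
    rw [ell_ne (by linarith [ht.1] : -t ≠ 0) , ← hs2.tsum_eq]
    congr 1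
    funext n
    have := ht.1.ne'
    simp only [F]
    rw [pow_succ, mul_div_assoc, mul_div_right_comm, neg_pow t n]
    field_simp
  rw [h2, ← intervalIntegral.integral_of_le zero_le_one, intervalIntegral.integral_comp_neg] at h1
  rw [Li2_eq, intervalIntegral.integral_symm, ← h1]
  simp

lemma ell_log {x : ℝ} (h : x ≠ 0) : ell x = -(Real.log (1 - x) / x) := by rw [ell_ne h, neg_div]

/-- inversion -/
lemma Li2_inv {u : ℝ} (hu : 0 < u) : Li2 (-u) = -(π^2/6) - Real.log u ^2 / 2 - Li2 (-u⁻¹) := by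
  let φ : ℝ → ℝ := fun u => Li2 (-u) + Li2 (-u⁻¹) + Real.log u ^ 2 / 2
  have hd : ∀ x ∈ Set.Ioi (0:ℝ), HasDerivAt φ 0 x := by
    intro x hx
    have hx : 0 < x := hx
    have hi : 0 < x⁻¹ := inv_pos.2 hx
    have d1 : HasDerivAt (fun u : ℝ => Li2 (-u)) (ell (-x) * (-1)) x :=
      (Li2_deriv (by linarith : -x < 1)).comp x (hasDerivAt_neg x)
    have d2 : HasDerivAt (fun u : ℝ => Li2 (-u⁻¹)) (ell (-x⁻¹) * (-(-(x^2)⁻¹))) x :=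
      Li2_comp (f := fun u => -u⁻¹) (hasDerivAt_inv hx.ne').neg (by linarith : -x⁻¹ < 1)
    have d3 := ((Real.hasDerivAt_log hx.ne').pow 2).div_const 2
    refine ((d1.add d2).add d3).congr_deriv ?_
    rw [ell_ne (by linarith), ell_ne (by linarith)]
    have : 1 - -x⁻¹ = (1 + x)/x := by field_simp; ring
    rw [this, Real.log_div (by linarith) hx.ne']
    simp only [sub_neg_eq_add]
    field_simp
    ring
  have hc : φ u = φ 1 := by
    apply (convex_Ioi (0:ℝ)).is_const_of_fderivWithin_eq_zero (𝕜 := ℝ)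
    · exact fun x hx => (hd x hx).differentiableAt.differentiableWithinAt
    · intro x hx
      rw [fderivWithin_of_isOpen isOpen_Ioi hx]
      have := (hd x hx).hasFDerivAt.fderiv
      rw [this]; ext; simp
    · exact hu
    · exact Set.mem_Ioi.2 one_pos
  simp only [φ, inv_one, Real.log_one, Li2_neg_one] at hc
  linarith

/-- Landen -/
lemma Li2_landen {a : ℝ} (ha : 0 < a) : Li2 (a / (1 + a)) = - Li2 (-a) - Real.log (1 + a)^2/2 := by
  let φ : ℝ → ℝ := fun u => Li2 (u / (1 + u)) + Li2 (-u) + Real.log (1 + u) ^ 2 / 2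
  have hd : ∀ x ∈ Set.Ioi (-1:ℝ), HasDerivAt φ 0 x := by
    intro x hx
    have hx : -1 < x := hx
    have hp : 0 < 1 + x := by linarith
    have hlt : x / (1 + x) < 1 := by rw [div_lt_one hp]; linarith
    have d1 : HasDerivAt (fun u : ℝ => Li2 (-u)) (ell (-x) * (-1)) x :=
      (Li2_deriv (by linarith : -x < 1)).comp x (hasDerivAt_neg x)
    have dd : HasDerivAt (fun u : ℝ => u / (1 + u)) (1/(1+x)^2) x := by
      refine ((hasDerivAt_id x).div ((hasDerivAt_id x).const_add 1) (by simpa using hp.ne')).congr_deriv ?_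
      simp only [id]
      congr 1
      ring
    have d2 : HasDerivAt (fun u : ℝ => Li2 (u/(1+u))) (ell (x/(1+x)) * (1/(1+x)^2)) x :=
      Li2_comp dd hlt
    have d3 := ((((hasDerivAt_id x).const_add 1).log (by simpa using hp.ne')).pow 2).div_const 2
    refine ((d2.add d1).add d3).congr_deriv ?_
    by_cases h0 : x = 0
    · subst h0; simp [ell]
    rw [ell_ne (div_ne_zero h0 hp.ne'), ell_ne (neg_ne_zero.2 h0)]
    have : 1 - x/(1+x) = (1 + x)⁻¹ := by field_simp; ring
    rw [this, Real.log_inv]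
    simp only [sub_neg_eq_add, id]
    field_simp
    ring
  have hc : φ a = φ 0 := by
    apply (convex_Ioi (-1:ℝ)).is_const_of_fderivWithin_eq_zero (𝕜 := ℝ)
    · exact fun x hx => (hd x hx).differentiableAt.differentiableWithinAt
    · intro x hx
      rw [fderivWithin_of_isOpen isOpen_Ioi hx]
      have := (hd x hx).hasFDerivAt.fderiv
      rw [this]; ext; simp
    · exact Set.mem_Ioi.2 (by linarith)
    · exact Set.mem_Ioi.2 (by norm_num)
  simp [φ, Li2_zero] at hc
  linarith

lemma ell_mul {t : ℝ} : ell (-t) * t = Real.log (1 + t) := by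
  by_cases h : t = 0
  · subst h; simp
  · rw [ell_ne (neg_ne_zero.2 h)]
    field_simp
    simp

noncomputable def g (a x : ℝ) : ℝ := ell ((a - x) / (1 + a)) / (1 + a)

lemma g_mul {a x : ℝ} (ha : 0 < a) (hx : 0 ≤ x) :
    g a x * (x - a) = Real.log (1 + x) - Real.log (1 + a) := by
  have hc : 0 < 1 + a := by linarith
  have h := ell_mul (t := (x - a)/(1+a))
  have e : -((x - a)/(1+a)) = (a - x)/(1+a) := by ring
  have e2 : 1 + (x - a)/(1+a) = (1 + x)/(1+a) := by field_simp; ring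
  rw [e, e2, Real.log_div (by linarith) hc.ne'] at h
  rw [← h, g]; ring

lemma g_eq {a x : ℝ} (ha : 0 < a) (hx : 0 ≤ x) (hxa : x ≠ a) :
    g a x = (Real.log (1 + x) - Real.log (1 + a)) / (x - a) := by
  rw [← g_mul ha hx, mul_div_cancel_right₀ _ (sub_ne_zero.2 hxa)]

lemma g_nonneg {a x : ℝ} (ha : 0 < a) (hx : 0 ≤ x) : 0 ≤ g a x := by
  rcases lt_trichotomy x a with h | h | h
  · rw [g_eq ha hx h.ne]
    apply div_nonneg_of_nonpos
    · have := Real.log_le_log (by linarith : 0 < 1 + x) (by linarith : 1 + x ≤ 1 + a)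
      linarith
    · linarith
  · subst h
    simp [g, ell]; linarith
  · rw [g_eq ha hx h.ne']
    apply div_nonneg
    · have := Real.log_le_log (by linarith : 0 < 1 + a) (by linarith : 1 + a ≤ 1 + x)
      linarith
    · linarith

noncomputable def H (a b x : ℝ) : ℝ :=
  -Li2 ((a - x)/(1 + a)) - Real.log (1 + x) * Real.log (1 + x + b) + Real.log (1 + x)^2/2
    + Li2 (-(b / (1 + x))) + Real.log (1 + a) * Real.log (1 + x + b)

lemma H_deriv {a b x : ℝ} (ha : 0 < a) (hb : 0 ≤ b) (hx : 0 ≤ x) :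
    HasDerivAt (H a b) ((1 + a + b) * g a x / (1 + b + x)) x := by
  have hc : 0 < 1 + a := by linarith
  have hs : 0 < 1 + x := by linarith
  have hsb : 0 < 1 + x + b := by linarith
  have i := (hasDerivAt_id x)
  have ds : HasDerivAt (fun x : ℝ => 1 + x) 1 x := i.const_add 1
  have dsb : HasDerivAt (fun x : ℝ => 1 + x + b) 1 x := ds.add_const b
  have l1 := ds.log hs.ne'
  have l2 := dsb.log hsb.ne'
  have dl1 : HasDerivAt (fun x => Li2 ((a - x)/(1+a))) (ell ((a - x)/(1+a)) * (-1/(1+a))) x :=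
    Li2_comp (f := fun x => (a - x)/(1+a)) ((i.const_sub a).div_const (1+a))
      (by rw [div_lt_one hc]; linarith)
  have dq : HasDerivAt (fun x : ℝ => -(b/(1+x))) (b/(1+x)^2) x := by
    refine ((hasDerivAt_const x b).div ds hs.ne').neg.congr_deriv ?_
    ring
  have dl2 : HasDerivAt (fun x => Li2 (-(b/(1+x)))) (ell (-(b/(1+x))) * (b/(1+x)^2)) x :=
    Li2_comp (f := fun x => -(b/(1+x))) dq (by have : 0 ≤ b/(1+x) := by positivity
                                               linarith)
  have D := (((dl1.neg.sub (l1.mul l2)).add ((l1.pow 2).div_const 2)).add dl2).add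
    (l2.const_mul (Real.log (1+a)))
  refine D.congr_deriv ?_
  have h1 : ell (-(b/(1+x))) * (b/(1+x)^2) = (Real.log (1+x+b) - Real.log (1+x))/(1+x) := by
    rw [← Real.log_div hsb.ne' hs.ne']
    have : (1 + x + b)/(1+x) = 1 + b/(1+x) := by field_simp
    rw [this, ← ell_mul]
    field_simp
  have h2 : ell ((a - x)/(1+a)) * (-1/(1+a)) = - g a x := by rw [g]; ring
  have h3 := g_mul ha hx
  have h4 : Real.log (1+x) = g a x * (x - a) + Real.log (1 + a) := by linarith
  rw [h1, h2, h4]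
  have h5 : 1 + b + x ≠ 0 := by linarith
  push_cast
  field_simp
  ring

noncomputable def Q (a x : ℝ) : ℝ :=
  -((Real.log (1 + x) - Real.log (1 + a))/(1 + x + a)) + (Real.log (1+x) - Real.log (1+x+a))/a

lemma Q_deriv {a x : ℝ} (ha : 0 < a) (hx : 0 ≤ x) :
    HasDerivAt (Q a) (g a x * (x - a) / (1 + a + x)^2) x := by
  have hc : 0 < 1 + a := by linarith
  have hs : 0 < 1 + x := by linarith
  have hsb : 0 < 1 + x + a := by linarith
  have i := (hasDerivAt_id x)
  have ds : HasDerivAt (fun x : ℝ => 1 + x) 1 x := i.const_add 1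
  have dsb : HasDerivAt (fun x : ℝ => 1 + x + a) 1 x := ds.add_const a
  have l1 := ds.log hs.ne'
  have l2 := dsb.log hsb.ne'
  have D := ((l1.sub_const (Real.log (1+a))).div dsb hsb.ne').neg.add ((l1.sub l2).div_const a)
  refine D.congr_deriv ?_
  rw [g_mul ha hx]
  have h5 : 1 + a + x ≠ 0 := by linarith
  field_simp
  ring

open Filter Topology

lemma lim_log_div : Tendsto (fun s : ℝ => Real.log s / s) atTop (𝓝 0) := by
  simpa using Real.tendsto_pow_log_div_mul_add_atTop 1 0 1 one_ne_zero

lemma lim_E (k : ℝ) :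
    Tendsto (fun s : ℝ => Real.log s * (Real.log (s + k) - Real.log s)) atTop (𝓝 0) := by
  have h := lim_log_div.mul (Real.tendsto_mul_log_one_add_div_atTop k)
  rw [zero_mul] at h
  refine h.congr' ?_
  filter_upwards [eventually_gt_atTop 0, eventually_gt_atTop (-k)] with s h0 hk
  rw [← Real.log_div (by linarith) h0.ne']
  have : (s + k)/s = 1 + k/s := by field_simp
  rw [this]; field_simp

lemma lim_E0 (k : ℝ) :
    Tendsto (fun s : ℝ => (Real.log (s + k) - Real.log s)) atTop (𝓝 0) := by
  have h := (tendsto_inv_atTop_zero (𝕜 := ℝ)).mul (Real.tendsto_mul_log_one_add_div_atTop k)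
  rw [zero_mul] at h
  refine h.congr' ?_
  filter_upwards [eventually_gt_atTop 0, eventually_gt_atTop (-k)] with s h0 hk
  rw [← Real.log_div (by linarith) h0.ne']
  have : (s + k)/s = 1 + k/s := by field_simp
  rw [this]; field_simp

lemma lim_one_add : Tendsto (fun x : ℝ => 1 + x) atTop atTop :=
  tendsto_atTop_add_const_left _ _ tendsto_id

lemma Li2_lim {f : ℝ → ℝ} (hf : Tendsto f atTop (𝓝 0)) :
    Tendsto (fun x => Li2 (f x)) atTop (𝓝 0) := by
  have h := (Li2_deriv (x := 0) (by norm_num)).continuousAt.tendsto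
  rw [Li2_zero] at h
  exact h.comp hf

lemma H_lim {a b : ℝ} (ha : 0 < a) :
    Tendsto (H a b) atTop (𝓝 (π^2/6 + Real.log (1+a)^2/2)) := by
  have hc : 0 < 1 + a := by linarith
  have A0 := (lim_E0 (-(1+a))).comp lim_one_add
  have A1 := (lim_E (-(1+a))).comp lim_one_add
  have B0 := (lim_E0 b).comp lim_one_add
  have B1 := (lim_E b).comp lim_one_add
  have t1 : Tendsto (fun x : ℝ => -(b/(1+x))) atTop (𝓝 0) := by
    simpa using (lim_one_add.const_div_atTop b).neg
  have hxa : Tendsto (fun x : ℝ => x - a) atTop atTop := tendsto_atTop_add_const_right _ _ tendsto_id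
  have t2 : Tendsto (fun x : ℝ => -((x-a)/(1+a))⁻¹) atTop (𝓝 0) := by
    have := (hxa.const_div_atTop (1+a)).neg
    simpa using this
  have L := Real.log (1+a)
  have T := ((((((A0.pow 2).div_const 2).add A1).sub (A0.const_mul (Real.log (1+a)))).sub B1).add
    (B0.const_mul (Real.log (1+a)))).add ((Li2_lim t1).add (Li2_lim t2))
  have T2 := T.const_add (π^2/6 + Real.log (1+a)^2/2)
  have e : π^2/6 + Real.log (1+a)^2/2 = π^2/6 + Real.log (1+a)^2/2 + (0 ^ 2 / 2 + 0 - Real.log (1 + a) * 0 - 0 + Real.log (1 + a) * 0 + (0 + 0)) := by ring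
  rw [e]
  refine T2.congr' ?_
  filter_upwards [eventually_gt_atTop a] with x hx
  have hxa : 0 < x - a := by linarith
  have hu : 0 < (x - a)/(1+a) := by positivity
  have h := Li2_inv hu
  have e1 : -((x - a)/(1+a)) = (a - x)/(1+a) := by ring
  rw [e1, Real.log_div hxa.ne' hc.ne'] at h
  have e2 : 1 + x + -(1 + a) = x - a := by ring
  simp only [H, Function.comp, h, e2]
  ring

lemma Q_lim {a : ℝ} (ha : 0 < a) : Tendsto (Q a) atTop (𝓝 0) := by
  have A0 := (((lim_E0 a).comp lim_one_add).div_const a).neg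
  have h1 : Tendsto (fun x : ℝ => Real.log (1+x) / (1 + x + a)) atTop (𝓝 0) := by
    have := (Real.tendsto_pow_log_div_mul_add_atTop 1 a 1 one_ne_zero).comp lim_one_add
    simpa [Function.comp_def] using this
  have h2 : Tendsto (fun x : ℝ => Real.log (1+a) / (1 + x + a)) atTop (𝓝 0) :=
    (tendsto_atTop_add_const_right _ a lim_one_add).const_div_atTop _
  have T := (h1.sub h2).neg.add A0
  simp only [sub_zero, neg_zero, zero_div, add_zero] at T
  refine T.congr ?_
  intro x
  simp only [Q, Function.comp]
  ring

/-- The one-dimensional integrand after integrating out the second variable. -/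
noncomputable def T (a b x : ℝ) : ℝ := g a x / ((1 + a + x)^2 * (1 + b + x))

noncomputable def W (a b x : ℝ) : ℝ :=
  (H a a x / (1 + 2*a) - Q a x) / (1 + 2*a) / (b - a)
    - (H a a x / (1 + 2*a) - H a b x / (1 + a + b)) / (b - a)^2

lemma W_deriv {a b x : ℝ} (ha : 0 < a) (hb : 0 ≤ b) (hab : a ≠ b) (hx : 0 ≤ x) :
    HasDerivAt (W a b) (T a b x) x := by
  have h1 := H_deriv ha ha.le hx
  have h2 := H_deriv ha hb hx
  have h3 := Q_deriv ha hx
  have D := ((((h1.div_const (1+2*a)).sub h3).div_const (1+2*a)).div_const (b-a)).sub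
    (((h1.div_const (1+2*a)).sub (h2.div_const (1+a+b))).div_const ((b-a)^2))
  refine D.congr_deriv ?_
  have k1 : 1 + 2*a ≠ 0 := by linarith
  have k2 : 1 + a + b ≠ 0 := by linarith
  have k3 : b - a ≠ 0 := sub_ne_zero.2 hab.symm
  have k4 : 1 + a + x ≠ 0 := by linarith
  have k5 : 1 + b + x ≠ 0 := by linarith
  rw [T]
  field_simp
  ring

lemma W_lim {a b : ℝ} (ha : 0 < a) :
    Tendsto (W a b) atTop (𝓝 (((π^2/6 + Real.log (1+a)^2/2) / (1 + 2*a) - 0) / (1 + 2*a) / (b - a)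
    - ((π^2/6 + Real.log (1+a)^2/2) / (1 + 2*a) - (π^2/6 + Real.log (1+a)^2/2) / (1 + a + b)) / (b - a)^2)) := by
  have h1 := H_lim (b := a) ha
  have h2 := H_lim (b := b) ha
  have h3 := Q_lim ha
  exact ((((h1.div_const (1+2*a)).sub h3).div_const (1+2*a)).div_const (b-a)).sub
    (((h1.div_const (1+2*a)).sub (h2.div_const (1+a+b))).div_const ((b-a)^2))

lemma T_nonneg {a b x : ℝ} (ha : 0 < a) (hb : 0 ≤ b) (hx : 0 ≤ x) : 0 ≤ T a b x := by
  have := g_nonneg ha hx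
  rw [T]; positivity

lemma T_int {a b : ℝ} (ha : 0 < a) (hb : 0 ≤ b) (hab : a ≠ b) :
    IntegrableOn (T a b) (Set.Ioi 0) :=
  integrableOn_Ioi_deriv_of_nonneg' (g := W a b) (fun _ hx => W_deriv ha hb hab hx)
    (fun _ hx => T_nonneg ha hb (le_of_lt hx)) (W_lim ha)

lemma T_integral {a b : ℝ} (ha : 0 < a) (hb : 0 ≤ b) (hab : a ≠ b) :
    ∫ x in Set.Ioi 0, T a b x = -Li2 (-a) / ((1 + 2 * a) ^ 2 * (1 + a + b))
        - (π ^ 2 / 6 - Real.log (1 + a) ^ 2 - Li2 (-a)) / ((1 + 2 * a) * (a - b) ^ 2)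
        - (π ^ 2 / 6 - Real.log (1 + a) ^ 2 - Li2 (-a)) / ((1 + 2 * a) ^ 2 * (a - b))
        + (π ^ 2 / 6 - Real.log (1 + b) * Real.log (1 + a) - Li2 (-b))
            / ((1 + a + b) * (a - b) ^ 2)
        + Real.log (1 + a) / (a * (1 + a) * (1 + 2 * a) * (a - b)) := by
  have h := integral_Ioi_of_hasDerivAt_of_nonneg' (g := W a b) (fun _ hx => W_deriv ha hb hab hx)
    (fun _ hx => T_nonneg ha hb (le_of_lt hx)) (W_lim ha)
  rw [h]
  have k1 : 1 + 2*a ≠ 0 := by linarith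
  have k2 : 1 + a + b ≠ 0 := by linarith
  have k3 : b - a ≠ 0 := sub_ne_zero.2 hab.symm
  have k4 : a - b ≠ 0 := sub_ne_zero.2 hab
  have k5 : 1 + a ≠ 0 := by linarith
  simp only [W, H, Q, sub_zero, add_zero, Real.log_one, div_one, Li2_landen ha]
  generalize Li2 (-a) = A
  generalize Li2 (-b) = B
  generalize Real.log (1+a) = L
  generalize Real.log (1+b) = M
  obtain ⟨d, rfl⟩ : ∃ d, b = a - d := ⟨a - b, by ring⟩
  have e : a - (a - d) = d := by ring
  have kd : d ≠ 0 := by rwa [e] at k4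
  have e3 : a - d - a = -d := by ring
  simp only [e, e3]
  field_simp
  ring
lemma inner {a b x : ℝ} (ha : 0 < a) (hb : 0 ≤ b) (hx : 0 < x) (hxa : x ≠ a) :
    IntegrableOn (fun y => 1 / ((1 + x + y) * (1 + a + x) ^ 2 * (1 + a + y) * (1 + b + x)))
      (Set.Ioi 0) ∧
    ∫ y in Set.Ioi 0, 1 / ((1 + x + y) * (1 + a + x) ^ 2 * (1 + a + y) * (1 + b + x)) = T a b x := by
  let R : ℝ → ℝ := fun y => (Real.log (y + (1 + a)) - Real.log (y + (1 + x)))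
    / ((x - a) * ((1 + a + x)^2 * (1 + b + x)))
  have k1 : x - a ≠ 0 := sub_ne_zero.2 hxa
  have k2 : 1 + a + x ≠ 0 := by linarith
  have k3 : 1 + b + x ≠ 0 := by linarith
  have hd : ∀ y ∈ Set.Ici (0:ℝ), HasDerivAt R
      (1 / ((1 + x + y) * (1 + a + x) ^ 2 * (1 + a + y) * (1 + b + x))) y := by
    intro y hy
    have hy : 0 ≤ y := hy
    have h1 : y + (1 + a) ≠ 0 := by linarith
    have h2 : y + (1 + x) ≠ 0 := by linarith
    have h3 : 1 + a + y ≠ 0 := by linarith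
    have h4 : 1 + x + y ≠ 0 := by linarith
    have d1 := ((hasDerivAt_id y).add_const (1 + a)).log h1
    have d2 := ((hasDerivAt_id y).add_const (1 + x)).log h2
    refine ((d1.sub d2).div_const _).congr_deriv ?_
    simp only [id]
    field_simp
    ring
  have hp : ∀ y ∈ Set.Ioi (0:ℝ),
      0 ≤ 1 / ((1 + x + y) * (1 + a + x) ^ 2 * (1 + a + y) * (1 + b + x)) := by
    intro y hy
    have hy : 0 < y := hy
    positivity
  have hl : Tendsto R atTop (𝓝 0) := by
    have := ((lim_E0 (1 + a)).sub (lim_E0 (1 + x))).div_const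
      ((x - a) * ((1 + a + x)^2 * (1 + b + x)))
    simpa [R] using this
  refine ⟨integrableOn_Ioi_deriv_of_nonneg' hd hp hl, ?_⟩
  rw [integral_Ioi_of_hasDerivAt_of_nonneg' hd hp hl, T, g_eq ha hx.le hxa]
  simp only [R, zero_add]
  field_simp
  ring
end G3

/-- Planar graph amplitude `Γ₃`. -/
theorem graph_amplitude_Gamma3 (p₁ p₂ : ℝ) (hp₁ : 0 < p₁) (hp₂ : 0 ≤ p₂) (hne : p₁ ≠ p₂) :
    IntegrableOn
      (fun q : ℝ × ℝ => 1 / ((1 + q.1 + q.2) * (1 + p₁ + q.1) ^ 2 * (1 + p₁ + q.2)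
        * (1 + p₂ + q.1)))
      (Set.Ici 0 ×ˢ Set.Ici 0) ∧
    ∫ q in (Set.Ici (0:ℝ) ×ˢ Set.Ici (0:ℝ)),
        1 / ((1 + q.1 + q.2) * (1 + p₁ + q.1) ^ 2 * (1 + p₁ + q.2) * (1 + p₂ + q.1))
      = -Li2 (-p₁) / ((1 + 2 * p₁) ^ 2 * (1 + p₁ + p₂))
        - (π ^ 2 / 6 - Real.log (1 + p₁) ^ 2 - Li2 (-p₁)) / ((1 + 2 * p₁) * (p₁ - p₂) ^ 2)
        - (π ^ 2 / 6 - Real.log (1 + p₁) ^ 2 - Li2 (-p₁)) / ((1 + 2 * p₁) ^ 2 * (p₁ - p₂))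
        + (π ^ 2 / 6 - Real.log (1 + p₂) * Real.log (1 + p₁) - Li2 (-p₂))
            / ((1 + p₁ + p₂) * (p₁ - p₂) ^ 2)
        + Real.log (1 + p₁) / (p₁ * (1 + p₁) * (1 + 2 * p₁) * (p₁ - p₂)) := by
  have hr : (volume : Measure (ℝ × ℝ)).restrict (Set.Ici 0 ×ˢ Set.Ici 0)
      = (volume.restrict (Set.Ioi (0:ℝ))).prod (volume.restrict (Set.Ioi (0:ℝ))) := by
    rw [Measure.volume_eq_prod, ← Measure.prod_restrict,
      Measure.restrict_congr_set (Ioi_ae_eq_Ici (a := (0:ℝ))).symm]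
  have hae : ∀ᵐ x ∂(volume.restrict (Set.Ioi (0:ℝ))), 0 < x ∧ x ≠ p₁ := by
    filter_upwards [ae_restrict_mem measurableSet_Ioi,
      ae_restrict_of_ae (Measure.ae_ne volume p₁)] with x h1 h2
    exact ⟨h1, h2⟩
  have hI : Integrable (fun q : ℝ × ℝ => 1 / ((1 + q.1 + q.2) * (1 + p₁ + q.1) ^ 2 * (1 + p₁ + q.2)
        * (1 + p₂ + q.1))) ((volume.restrict (Set.Ioi (0:ℝ))).prod (volume.restrict (Set.Ioi (0:ℝ)))) := by
    rw [integrable_prod_iff]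
    · constructor
      · filter_upwards [hae] with x hx
        exact (G3.inner hp₁ hp₂ hx.1 hx.2).1
      · refine (G3.T_int hp₁ hp₂ hne).congr ?_
        filter_upwards [hae] with x hx
        rw [← (G3.inner hp₁ hp₂ hx.1 hx.2).2]
        apply setIntegral_congr_fun measurableSet_Ioi
        intro y hy
        have hy : 0 < y := hy
        have hx0 := hx.1
        refine (Real.norm_of_nonneg ?_).symm
        positivity
    · apply Measurable.aestronglyMeasurable
      fun_prop
  refine ⟨by rw [IntegrableOn, hr]; exact hI, ?_⟩
  rw [hr, integral_prod _ hI, ← G3.T_integral hp₁ hp₂ hne]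
  apply integral_congr_ae
  filter_upwards [hae] with x hx
  exact (G3.inner hp₁ hp₂ hx.1 hx.2).2
end
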